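/- arXiv:1706.08330 — 2 statements merged into one kernel-verified Lean document; each statement's English description precedes it below -/
import Mathlib

section
/- The unique end of a transitive one-ended graph has infinite vertex degree; that is, if G is a graph with exactly one end whose automorphism group acts transitively on the vertices, then G contains an infinite family of pairwise disjoint rays belonging to that end. -/
open Set Cardinal

namespace PaperEnds

/-- A ray in `G`: a one-sided infinite path, i.e. an injective sequence of
pairwise adjacent consecutive vertices. -/
def IsRay {V : Type} (G : SimpleGraph V) (r : ℕ → V) : Prop :=
  Function.Injective r ∧ ∀ n, G.Adj (r n) (r (n + 1))

/-- `a` and `b` are connected by a walk avoiding the vertex set `S`. -/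
def ReachableOutside {V : Type} (G : SimpleGraph V) (S : Set V) (a b : V) : Prop :=
  ∃ w : G.Walk a b, ∀ v ∈ w.support, v ∉ S

/-- Two rays are equivalent (belong to the same end) if for every finite vertex
set `S` they have tails lying in the same component of `G − S`. -/
def RayEquiv {V : Type} (G : SimpleGraph V) (r₁ r₂ : ℕ → V) : Prop :=
  ∀ S : Set V, S.Finite → ∃ m n : ℕ,
    (∀ i, m ≤ i → r₁ i ∉ S) ∧ (∀ j, n ≤ j → r₂ j ∉ S) ∧
    ReachableOutside G S (r₁ m) (r₂ n)

/-- `r` is a ray belonging to the end represented by the ray `ω`. -/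
def InEnd {V : Type} (G : SimpleGraph V) (ω r : ℕ → V) : Prop :=
  IsRay G r ∧ RayEquiv G r ω

/-- `G` has exactly one end: it has a ray and any two rays are equivalent. -/
def OneEnded {V : Type} (G : SimpleGraph V) : Prop :=
  (∃ r, IsRay G r) ∧ ∀ r₁ r₂, IsRay G r₁ → IsRay G r₂ → RayEquiv G r₁ r₂

/-- A family of pairwise (vertex-)disjoint rays. -/
def DisjointRays {V : Type} {ι : Type} (f : ι → ℕ → V) : Prop :=
  Pairwise fun i j => Disjoint (Set.range (f i)) (Set.range (f j))

/-- The end represented by `ω` has vertex degree `k`: the maximum cardinality of a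
family of pairwise disjoint rays belonging to the end is `k`. -/
def EndVertexDegree {V : Type} (G : SimpleGraph V) (ω : ℕ → V) (k : ℕ) : Prop :=
  (∃ f : Fin k → ℕ → V, (∀ i, InEnd G ω (f i)) ∧ DisjointRays f) ∧
  ¬ ∃ f : Fin (k + 1) → ℕ → V, (∀ i, InEnd G ω (f i)) ∧ DisjointRays f

/-- `v` dominates the end represented by `ω`: for every ray `r` in the end there are
infinitely many `v`–`r` paths pairwise meeting only in `v`. -/
def Dominates {V : Type} (G : SimpleGraph V) (v : V) (ω : ℕ → V) : Prop :=
  ∀ r : ℕ → V, InEnd G ω r →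
    ∃ (t : ℕ → ℕ) (P : (n : ℕ) → G.Walk v (r (t n))),
      Function.Injective t ∧
      (∀ n, (P n).IsPath) ∧
      (∀ n, ∀ u ∈ (P n).support, u ∈ Set.range r → u = r (t n)) ∧
      (∀ m n, m ≠ n → ∀ u, u ∈ (P m).support → u ∈ (P n).support → u = v)

/-- The end represented by `ω` is undominated. -/
def Undominated {V : Type} (G : SimpleGraph V) (ω : ℕ → V) : Prop :=
  ¬ ∃ v, Dominates G v ω

/-- `(A, B)` is a separation of `G`. -/
def IsSeparation {V : Type} (G : SimpleGraph V) (A B : Set V) : Prop :=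
  A ∪ B = Set.univ ∧ ∀ a ∈ A \ B, ∀ b ∈ B \ A, ¬ G.Adj a b

/-- The order of a separation `(A, B)`, i.e. `|A ∩ B|` as an extended natural number. -/
noncomputable def SepOrder {V : Type} (A B : Set V) : ℕ∞ := (A ∩ B).encard

/-- The end represented by `ω` lies in the side `B`: every ray of the end has all
but finitely many vertices in `B`. -/
def LiesIn {V : Type} (G : SimpleGraph V) (ω : ℕ → V) (B : Set V) : Prop :=
  ∀ r, InEnd G ω r → ∃ m, ∀ n, m ≤ n → r n ∈ B

/-- The vertex set `s` is connected in `G` (any two of its vertices are joined by a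
walk inside `s`). -/
def ConnectedIn {V : Type} (G : SimpleGraph V) (s : Set V) : Prop :=
  ∀ a ∈ s, ∀ b ∈ s, ∃ w : G.Walk a b, ∀ v ∈ w.support, v ∈ s

/-- `(A, B)` is an ω-relevant separation (for the end of vertex degree `k`
represented by the ray `ω`). -/
def Relevant {V : Type} (G : SimpleGraph V) (ω : ℕ → V) (k : ℕ) (A B : Set V) : Prop :=
  IsSeparation G A B ∧ SepOrder A B = (k : ℕ∞) ∧
  ConnectedIn G (A \ B) ∧
  (∀ v ∈ A ∩ B, ∃ u ∈ A \ B, G.Adj v u) ∧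
  LiesIn G ω B ∧
  ¬ ∃ C D : Set V, IsSeparation G C D ∧ SepOrder C D < (k : ℕ∞) ∧ A ⊆ C ∧ LiesIn G ω D

/-- Two separations `(A, B)` and `(C, D)` are nested. -/
def Nested {V : Type} (A B C D : Set V) : Prop :=
  (A ⊆ C ∧ D ⊆ B) ∨ (A ⊆ D ∧ C ⊆ B) ∨ (B ⊆ C ∧ D ⊆ A) ∨ (B ⊆ D ∧ C ⊆ A)

/-- Separations `(A, B)` of finite order with the (unique) end in `B`. -/
structure Sp {V : Type} (G : SimpleGraph V) (ω : ℕ → V) (A B : Set V) : Prop where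
  cov : ∀ v, v ∈ A ∨ v ∈ B
  adj : ∀ a b, G.Adj a b → a ∉ B → b ∈ A
  fin : (A ∩ B).Finite
  tail : ∃ m, ∀ n, m ≤ n → ω n ∈ B

section basics

variable {V : Type} {G : SimpleGraph V} {ω : ℕ → V}

lemma Sp.adj' {A B : Set V} (h : Sp G ω A B) {a b : V} (hab : G.Adj a b) (ha : a ∉ A) : b ∈ B := by
  by_contra hb
  exact ha (h.adj b a hab.symm hb)

lemma Sp.union {A B C D : Set V} (h : Sp G ω A B) (h' : Sp G ω C D) :
    Sp G ω (A ∪ C) (B ∩ D) := by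
  refine ⟨fun v => ?_, fun a b hab ha => ?_, ?_, ?_⟩
  · have := h.cov v; have := h'.cov v; simp only [mem_union, mem_inter_iff]; tauto
  · have := h.adj a b hab; have := h'.adj a b hab
    simp only [mem_union, mem_inter_iff] at *; tauto
  · refine (h.fin.union h'.fin).subset ?_
    rintro x ⟨h1, h2⟩
    simp only [mem_union, mem_inter_iff] at *; tauto
  · obtain ⟨m, hm⟩ := h.tail
    obtain ⟨m', hm'⟩ := h'.tail
    exact ⟨max m m', fun n hn => ⟨hm n (le_trans (le_max_left _ _) hn),
      hm' n (le_trans (le_max_right _ _) hn)⟩⟩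

lemma Sp.inter {A B C D : Set V} (h : Sp G ω A B) (h' : Sp G ω C D) :
    Sp G ω (A ∩ C) (B ∪ D) := by
  refine ⟨fun v => ?_, fun a b hab ha => ?_, ?_, ?_⟩
  · have := h.cov v; have := h'.cov v; simp only [mem_union, mem_inter_iff]; tauto
  · have := h.adj a b hab; have := h'.adj a b hab
    simp only [mem_union, mem_inter_iff] at *; tauto
  · refine (h.fin.union h'.fin).subset ?_
    rintro x ⟨h1, h2⟩
    simp only [mem_union, mem_inter_iff] at *; tauto
  · obtain ⟨m, hm⟩ := h.tail
    exact ⟨m, fun n hn => Or.inl (hm n hn)⟩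

lemma submod {A B C D T : Set V} (h : Sp G ω A B) (h' : Sp G ω C D) :
    (((A ∪ C) ∩ (B ∩ D)) \ T).ncard + (((A ∩ C) ∩ (B ∪ D)) \ T).ncard
      ≤ ((A ∩ B) \ T).ncard + ((C ∩ D) \ T).ncard := by
  have f1 : (((A ∪ C) ∩ (B ∩ D)) \ T).Finite := (h.union h').fin.sdiff
  have f2 : (((A ∩ C) ∩ (B ∪ D)) \ T).Finite := (h.inter h').fin.sdiff
  have f3 : ((A ∩ B) \ T).Finite := h.fin.sdiff
  have f4 : ((C ∩ D) \ T).Finite := h'.fin.sdiff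
  rw [← ncard_union_add_ncard_inter _ _ f1 f2, ← ncard_union_add_ncard_inter _ _ f3 f4]
  refine add_le_add (ncard_le_ncard ?_ (f3.union f4)) (ncard_le_ncard ?_ (f3.inter_of_left _))
  · intro x hx
    simp only [mem_union, mem_inter_iff, mem_sdiff] at *; tauto
  · intro x hx
    simp only [mem_union, mem_inter_iff, mem_sdiff] at *; tauto

lemma Sp.triv (G : SimpleGraph V) (ω : ℕ → V) {X : Set V} (hX : X.Finite) : Sp G ω X univ :=
  ⟨fun _ => Or.inr trivial, fun _ _ _ h => (h trivial).elim, hX.subset inter_subset_left,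
    0, fun _ _ => trivial⟩

lemma inj_tail {r : ℕ → V} (hr : Function.Injective r) {S : Set V} (hS : S.Finite) :
    ∃ m, ∀ n, m ≤ n → r n ∉ S := by
  have : (r ⁻¹' S).Finite := hS.preimage hr.injOn
  obtain ⟨m, hm⟩ := this.bddAbove
  exact ⟨m + 1, fun n hn h => absurd (hm h) (by omega)⟩

/-- Removing an inner vertex `c` from the side `B`. -/
lemma Sp.remove {A B : Set V} (hω : IsRay G ω) (h : Sp G ω A B) {c : V} (hc : c ∈ A)
    (hN : ∀ y, G.Adj c y → y ∈ A) : Sp G ω A (B \ {c}) := by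
  refine ⟨fun v => ?_, fun a b hab ha => ?_, h.fin.subset ?_, ?_⟩
  · by_cases hv : v = c
    · subst hv; exact Or.inl hc
    · rcases h.cov v with h1 | h1
      · exact Or.inl h1
      · exact Or.inr ⟨h1, hv⟩
  · by_cases hv : a = c
    · subst hv; exact hN b hab
    · exact h.adj a b hab (fun hb => ha ⟨hb, hv⟩)
  · exact inter_subset_inter_right _ sdiff_subset
  · obtain ⟨m, hm⟩ := h.tail
    obtain ⟨m', hm'⟩ := inj_tail hω.1 (finite_singleton c)
    exact ⟨max m m', fun n hn => ⟨hm n (le_trans (le_max_left _ _) hn),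
      hm' n (le_trans (le_max_right _ _) hn)⟩⟩

lemma walk_side {A B : Set V} (hadj : ∀ a b, G.Adj a b → a ∉ A → b ∈ B) {a b : V}
    (w : G.Walk a b) (hcov : ∀ v ∈ w.support, ¬ (v ∈ A ∧ v ∈ B)) (ha : a ∉ A) : b ∉ A := by
  induction w with
  | nil => exact ha
  | cons h p ih =>
    refine ih (fun v hv => hcov v (by simp [hv])) ?_
    intro hA
    exact hcov _ (by simp) ⟨hA, hadj _ _ h ha⟩

lemma tail_side {A B : Set V} (hadj : ∀ a b, G.Adj a b → a ∉ A → b ∈ B) {r : ℕ → V}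
    (hr : ∀ n, G.Adj (r n) (r (n + 1))) {m : ℕ} (hm : ∀ n, m ≤ n → ¬ (r n ∈ A ∧ r n ∈ B))
    (h0 : r m ∉ A) : ∀ n, m ≤ n → r n ∉ A := by
  intro n hn
  induction n, hn using Nat.le_induction with
  | base => exact h0
  | succ n hn ih =>
    intro hA
    exact hm (n + 1) (by omega) ⟨hA, hadj _ _ (hr n) ih⟩

/-- the end is eventually outside `A` -/
lemma Sp.tail' {A B : Set V} (hω : IsRay G ω) (h : Sp G ω A B) : ∃ m, ∀ n, m ≤ n → ω n ∉ A := by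
  obtain ⟨m, hm⟩ := h.tail
  obtain ⟨m', hm'⟩ := inj_tail hω.1 h.fin
  exact ⟨max m m', fun n hn hA => hm' n (le_trans (le_max_right _ _) hn)
    ⟨hA, hm n (le_trans (le_max_left _ _) hn)⟩⟩

lemma Sp.ray {A B : Set V} (hω : IsRay G ω) (hone : OneEnded G) (h : Sp G ω A B) {r : ℕ → V}
    (hr : IsRay G r) : ∃ m, ∀ n, m ≤ n → r n ∉ A := by
  obtain ⟨m, n, hm, hn, w, hw⟩ := hone.2 ω r hω hr (A ∩ B) h.fin
  have h1 : ω m ∉ A := by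
    intro hA
    have hB : ω m ∉ B := fun hB => hm m le_rfl ⟨hA, hB⟩
    have := tail_side (A := B) (B := A) h.adj hω.2 (m := m)
      (fun i hi hh => hm i hi ⟨hh.2, hh.1⟩) hB
    obtain ⟨m', hm'⟩ := h.tail
    exact this (max m m') (le_max_left _ _) (hm' _ (le_max_right _ _))
  have h2 : r n ∉ A := walk_side (fun a b => h.adj') w (fun v hv hh => hw v hv hh) h1
  exact ⟨n, tail_side (fun a b => h.adj') hr.2 (fun i hi hh => hn i hi hh) h2⟩

lemma ray_map {r : ℕ → V} (hr : IsRay G r) (φ : G ≃g G) : IsRay G (fun n => φ (r n)) :=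
  ⟨fun a b h => hr.1 (φ.injective h), fun n => φ.map_rel_iff.2 (hr.2 n)⟩

lemma Sp.preim {A B : Set V} (hω : IsRay G ω) (hone : OneEnded G) (h : Sp G ω A B) (φ : G ≃g G) :
    Sp G ω (φ ⁻¹' A) (φ ⁻¹' B) := by
  refine ⟨fun v => h.cov _, fun a b hab ha => h.adj _ _ (φ.map_rel_iff.2 hab) ha, ?_, ?_⟩
  · rw [← preimage_inter]
    exact h.fin.preimage φ.injective.injOn
  · obtain ⟨m, hm⟩ := h.ray hω hone (ray_map hω φ)
    exact ⟨m, fun n hn => (h.cov _).resolve_left (hm n hn)⟩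

lemma ncard_preim (φ : G ≃g G) (S : Set V) : (φ ⁻¹' S).ncard = S.ncard :=
  ncard_preimage_of_injective_subset_range φ.injective (fun x _ => φ.surjective x)

lemma conn (htrans : ∀ u v : V, ∃ φ : G ≃g G, φ u = v) (hone : OneEnded G) (hω : IsRay G ω) :
    ∀ u v, Nonempty (G.Walk u v) := by
  have hpre : ∀ r : ℕ → V, IsRay G r → ∀ n, Nonempty (G.Walk (r 0) (r n)) := by
    intro r hr n
    induction n with
    | zero => exact ⟨.nil⟩
    | succ n ih => exact ⟨ih.some.concat (hr.2 n)⟩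
  have h0 : ∀ v, Nonempty (G.Walk (ω 0) v) := by
    intro v
    obtain ⟨φ, hφ⟩ := htrans (ω 0) v
    obtain ⟨m, n, -, -, w, -⟩ := hone.2 ω _ hω (ray_map hω φ) ∅ finite_empty
    have a := (hpre ω hω m).some
    have b := (hpre _ (ray_map hω φ) n).some
    simp only [hφ] at b
    exact ⟨(a.append w).append b.reverse⟩
  intro u v
  exact ⟨(h0 u).some.reverse.append (h0 v).some⟩

/-- sets closed under adjacency are everything -/
lemma closed_univ (hc : ∀ u v, Nonempty (G.Walk u v)) {P : V → Prop} {x : V} (hx : P x)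
    (hP : ∀ a b, G.Adj a b → P a → P b) (y : V) : P y := by
  obtain ⟨w⟩ := hc x y
  induction w with
  | nil => exact hx
  | cons h p ih => exact ih (hP _ _ h hx)

/-- ultrafilter limits of separations -/
lemma limit_sep {ι : Type} (U : Ultrafilter ι) (A B : ι → Set V) (T : Set V) (n : ℕ)
    (hcov : ∀ v, ∀ᶠ i in U, v ∈ A i ∨ v ∈ B i)
    (hadj : ∀ a b, G.Adj a b → ∀ᶠ i in U, a ∉ B i → b ∈ A i)
    (hcard : ∀ᶠ i in U, ((A i ∩ B i) \ T).encard ≤ n) :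
    (∀ v, (∀ᶠ i in U, v ∈ A i) ∨ (∀ᶠ i in U, v ∈ B i)) ∧
    (∀ a b, G.Adj a b → ¬ (∀ᶠ i in U, a ∈ B i) → ∀ᶠ i in U, b ∈ A i) ∧
    (({v | ∀ᶠ i in U, v ∈ A i} ∩ {v | ∀ᶠ i in U, v ∈ B i}) \ T).encard ≤ n := by
  refine ⟨fun v => Ultrafilter.eventually_or.1 (hcov v), fun a b hab ha => ?_, ?_⟩
  · rw [← Ultrafilter.eventually_not] at ha
    filter_upwards [hadj a b hab, ha] with i h1 h2 using h1 h2
  · by_contra hlt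
    push Not at hlt
    have hle : ((n + 1 : ℕ) : ℕ∞) ≤ (({v | ∀ᶠ i in U, v ∈ A i} ∩ {v | ∀ᶠ i in U, v ∈ B i}) \ T).encard := by
      have := Order.add_one_le_of_lt hlt
      simpa using this
    obtain ⟨t, ht, htc⟩ := exists_subset_encard_eq hle
    have tfin : t.Finite := finite_of_encard_eq_coe htc
    have : ∀ᶠ i in U, ∀ v ∈ t, v ∈ (A i ∩ B i) \ T := by
      rw [Filter.eventually_all_finite tfin]
      intro v hv
      obtain ⟨⟨h1, h2⟩, h3⟩ := ht hv
      filter_upwards [h1, h2] with i g1 g2 using ⟨⟨g1, g2⟩, h3⟩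
    obtain ⟨i, hi1, hi2⟩ := (this.and hcard).exists
    have := (encard_le_encard hi1).trans hi2
    rw [htc] at this
    norm_cast at this
    omega

lemma inf_sep {X T A0 B0 : Set V} (hT : T.Finite) (h0 : Sp G ω A0 B0) (hX : X ⊆ A0) (n : ℕ)
    (hF : ∀ W : Finset V, ∃ A B, Sp G ω A B ∧ ↑W ∩ X ⊆ A ∧ ((A ∩ B) \ T).ncard ≤ n) :
    ∃ A B, Sp G ω A B ∧ X ⊆ A ∧ ((A ∩ B) \ T).ncard ≤ n := by
  classical
  have hex : ∃ m A0 B0, Sp G ω A0 B0 ∧ X ⊆ A0 ∧ ((A0 ∩ B0) \ T).ncard = m := ⟨_, A0, B0, h0, hX, rfl⟩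
  obtain ⟨A1, B1, h1, hX1, hm⟩ := Nat.find_spec hex
  have hmin : ∀ A B, Sp G ω A B → X ⊆ A → ((A1 ∩ B1) \ T).ncard ≤ ((A ∩ B) \ T).ncard := by
    intro A B h hXA
    rw [hm]
    exact Nat.find_min' hex ⟨A, B, h, hXA, rfl⟩
  have key : ∀ W : Finset V, ∃ A B, Sp G ω A B ∧ ↑W ∩ X ⊆ A ∧ B1 ⊆ B ∧ ((A ∩ B) \ T).ncard ≤ n := by
    intro W
    obtain ⟨A, B, h, hW, hn⟩ := hF W
    refine ⟨_, _, h.inter h1, subset_inter hW (inter_subset_right.trans hX1), subset_union_right, ?_⟩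
    have a := submod (T := T) h h1
    have b := hmin _ _ (h.union h1) (hX1.trans subset_union_right)
    omega
  choose A B hs hW hB hn using key
  let U : Ultrafilter (Finset V) := Ultrafilter.of Filter.atTop
  have hU : (U : Filter (Finset V)) ≤ Filter.atTop := Ultrafilter.of_le _
  obtain ⟨c1, c2, c3⟩ := limit_sep (G := G) U A B T n (fun v => Filter.Eventually.of_forall fun i => (hs i).cov v)
    (fun a b hab => Filter.Eventually.of_forall fun i => (hs i).adj a b hab)
    (Filter.Eventually.of_forall fun i => by
      rw [← ((hs i).fin.sdiff (t := T)).cast_ncard_eq]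
      exact_mod_cast hn i)
  have hfin := finite_of_encard_le_coe c3
  refine ⟨{v | ∀ᶠ i in U, v ∈ A i}, {v | ∀ᶠ i in U, v ∈ B i}, ⟨c1, c2, ?_, ?_⟩, ?_, ?_⟩
  · refine (hfin.union hT).subset ?_
    intro x hx
    by_cases hxT : x ∈ T
    · exact Or.inr hxT
    · exact Or.inl ⟨hx, hxT⟩
  · obtain ⟨m, hm⟩ := h1.tail
    exact ⟨m, fun k hk => Filter.Eventually.of_forall fun i => hB i (hm k hk)⟩
  · intro x hx
    have : ∀ᶠ W : Finset V in U, x ∈ W := by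
      apply hU
      filter_upwards [Filter.eventually_ge_atTop ({x} : Finset V)] with W hW
      exact hW (Finset.mem_singleton_self x)
    show ∀ᶠ i in U, x ∈ A i
    filter_upwards [this] with W hxW using hW W ⟨hxW, hx⟩
  · rw [← hfin.cast_ncard_eq] at c3
    exact_mod_cast c3

end basics

section rays

variable {V : Type} {G : SimpleGraph V} {ω : ℕ → V}

/-- the next time with the same label -/
def nxt (s : ℕ) : ℕ := Nat.pair (Nat.unpair s).1 ((Nat.unpair s).2 + 1)

lemma lt_nxt (s : ℕ) : s < nxt s := by
  have := Nat.pair_lt_pair_right (Nat.unpair s).1 (Nat.lt_succ_self (Nat.unpair s).2)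
  rwa [Nat.pair_unpair] at this

lemma nxt_inj {s t : ℕ} (h : nxt s = nxt t) : s = t := by
  unfold nxt at h
  rw [Nat.pair_eq_pair] at h
  rw [← Nat.pair_unpair s, ← Nat.pair_unpair t, h.1, Nat.succ_injective h.2]

open Classical in
/-- the invariant of the construction of infinitely many disjoint rays -/
structure Inv (G : SimpleGraph V) (L : Finset V → Finset V → Prop) (t : ℕ) (y : ℕ → V) : Prop where
  inj : ∀ a b, a < t → b < t → y a = y b → a = b
  link : L (((Finset.range t).filter (fun s => nxt s < t)).image y)
    (((Finset.range t).filter (fun s => t ≤ nxt s)).image y)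
  adj : ∀ s, nxt s < t → G.Adj (y s) (y (nxt s))

open Classical in
lemma many_rays (L : Finset V → Finset V → Prop) (v0 : V) (h0 : L ∅ ∅)
    (hmove : ∀ T X x, L T X → x ∈ X →
      ∃ y, G.Adj x y ∧ y ∉ T ∧ y ∉ X ∧ L (insert x T) (insert y (X.erase x)))
    (hadd : ∀ T X, L T X → ∃ y, y ∉ T ∧ y ∉ X ∧ L T (insert y X)) :
    ∃ f : ℕ → ℕ → V, (∀ i, IsRay G (f i)) ∧ DisjointRays f := by
  have step : ∀ t y, Inv G L t y → ∃ y', (∀ s, s < t → y' s = y s) ∧ Inv G L (t + 1) y' := by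
    intro t y hI
    have hupd : ∀ (z : V) s, s < t → Function.update y t z s = y s := by
      intro z s hs
      exact Function.update_of_ne (by omega) _ _
    have hcases : ∀ z : V, z ∉ ((Finset.range t).filter (fun s => nxt s < t)).image y →
        z ∉ ((Finset.range t).filter (fun s => t ≤ nxt s)).image y → ∀ s < t, y s ≠ z := by
      intro z h1 h2 s hs hz
      by_cases hn : nxt s < t
      · exact h1 (Finset.mem_image.2 ⟨s, by simp [hs, hn], hz⟩)
      · exact h2 (Finset.mem_image.2 ⟨s, by simp [hs]; omega, hz⟩)
    have hinj : ∀ z : V, (∀ s < t, y s ≠ z) → ∀ a b, a < t + 1 → b < t + 1 →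
        Function.update y t z a = Function.update y t z b → a = b := by
      intro z hz a b ha hb hab
      rcases Nat.lt_succ_iff_lt_or_eq.1 ha with ha | ha <;>
        rcases Nat.lt_succ_iff_lt_or_eq.1 hb with hb | hb
      · rw [hupd z a ha, hupd z b hb] at hab
        exact hI.inj a b ha hb hab
      · subst hb
        rw [hupd z a ha, Function.update_self] at hab
        exact (hz a ha hab).elim
      · subst ha
        rw [hupd z b hb, Function.update_self] at hab
        exact (hz b hb hab.symm).elim
      · omega
    by_cases hp : ∃ s, nxt s = t
    · obtain ⟨p, hp⟩ := hp
      have hpt : p < t := hp ▸ lt_nxt p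
      obtain ⟨z, hz1, hz2, hz3, hz4⟩ := hmove _ _ (y p) hI.link
        (Finset.mem_image.2 ⟨p, by simp [hpt, hp], rfl⟩)
      have hz := hcases z hz2 hz3
      refine ⟨Function.update y t z, hupd z, hinj z hz, ?_, ?_⟩
      · convert hz4 using 1
        · ext v
          simp only [Finset.mem_image, Finset.mem_filter, Finset.mem_range, Finset.mem_insert]
          constructor
          · rintro ⟨s, ⟨hs1, hs2⟩, rfl⟩
            have hst : s < t := by have := lt_nxt s; omega
            rw [hupd z s hst]
            rcases Nat.lt_succ_iff_lt_or_eq.1 hs2 with h | h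
            · exact Or.inr ⟨s, ⟨hst, h⟩, rfl⟩
            · exact Or.inl (by rw [nxt_inj (h.trans hp.symm)])
          · rintro (rfl | ⟨s, ⟨hs1, hs2⟩, rfl⟩)
            · exact ⟨p, ⟨by omega, by omega⟩, hupd z p hpt⟩
            · exact ⟨s, ⟨by omega, by omega⟩, hupd z s hs1⟩
        · ext v
          simp only [Finset.mem_image, Finset.mem_filter, Finset.mem_range, Finset.mem_insert,
            Finset.mem_erase]
          constructor
          · rintro ⟨s, ⟨hs1, hs2⟩, rfl⟩
            rcases Nat.lt_succ_iff_lt_or_eq.1 hs1 with h | h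
            · right
              rw [hupd z s h]
              refine ⟨fun he => ?_, s, ⟨h, by omega⟩, rfl⟩
              have := hI.inj _ _ h hpt he
              subst this
              omega
            · left; subst h; simp
          · rintro (rfl | ⟨hne, s, ⟨hs1, hs2⟩, rfl⟩)
            · exact ⟨t, ⟨by omega, lt_nxt t⟩, by simp⟩
            · refine ⟨s, ⟨by omega, ?_⟩, hupd z s hs1⟩
              rcases Nat.lt_or_eq_of_le hs2 with h | h
              · exact h
              · exact (hne (by rw [nxt_inj (h.symm.trans hp.symm)])).elim
      · intro s hs
        have hst : s < t := by have := lt_nxt s; omega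
        rw [hupd z s hst]
        rcases Nat.lt_succ_iff_lt_or_eq.1 hs with h | h
        · rw [hupd z _ h]; exact hI.adj s h
        · rw [h, Function.update_self, nxt_inj (h.trans hp.symm)]; exact hz1
    · push Not at hp
      obtain ⟨z, hz2, hz3, hz4⟩ := hadd _ _ hI.link
      have hz := hcases z hz2 hz3
      refine ⟨Function.update y t z, hupd z, hinj z hz, ?_, ?_⟩
      · convert hz4 using 1
        · ext v
          simp only [Finset.mem_image, Finset.mem_filter, Finset.mem_range]
          constructor
          · rintro ⟨s, ⟨hs1, hs2⟩, rfl⟩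
            have hst : s < t := by have := lt_nxt s; omega
            have := hp s
            exact ⟨s, ⟨hst, by omega⟩, (hupd z s hst).symm⟩
          · rintro ⟨s, ⟨hs1, hs2⟩, rfl⟩
            exact ⟨s, ⟨by omega, by omega⟩, hupd z s hs1⟩
        · ext v
          simp only [Finset.mem_image, Finset.mem_filter, Finset.mem_range, Finset.mem_insert]
          constructor
          · rintro ⟨s, ⟨hs1, hs2⟩, rfl⟩
            rcases Nat.lt_succ_iff_lt_or_eq.1 hs1 with h | h
            · right
              exact ⟨s, ⟨h, by omega⟩, (hupd z s h).symm⟩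
            · left; subst h; simp
          · rintro (rfl | ⟨s, ⟨hs1, hs2⟩, rfl⟩)
            · exact ⟨t, ⟨by omega, lt_nxt t⟩, by simp⟩
            · have := hp s
              exact ⟨s, ⟨by omega, by omega⟩, hupd z s hs1⟩
      · intro s hs
        have hst : s < t := by have := lt_nxt s; omega
        have := hp s
        rw [hupd z s hst, hupd z _ (by omega)]
        exact hI.adj s (by omega)
  choose! nx hnx1 hnx2 using step
  let Y : ℕ → ℕ → V := fun t => Nat.rec (fun _ => v0) (fun t y => nx t y) t
  have hY : ∀ t, Inv G L t (Y t) := by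
    intro t
    induction t with
    | zero => exact ⟨fun a b h => by omega, by simpa using h0, fun s h => by omega⟩
    | succ t ih => exact hnx2 t _ ih
  have hagree : ∀ s t, s < t → Y t s = Y (s + 1) s := by
    intro s t hst
    induction t, hst using Nat.le_induction with
    | base => rfl
    | succ t ht ih => rw [← ih]; exact hnx1 t _ (hY t) s ht
  let y : ℕ → V := fun s => Y (s + 1) s
  have hyinj : ∀ a b, y a = y b → a = b := by
    intro a b hab
    refine (hY (max a b + 1)).inj a b (by omega) (by omega) ?_
    rw [hagree a (max a b + 1) (by omega), hagree b (max a b + 1) (by omega)]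
    exact hab
  have hyadj : ∀ s, G.Adj (y s) (y (nxt s)) := by
    intro s
    have := (hY (nxt s + 1)).adj s (by omega)
    rwa [hagree s (nxt s + 1) (by have := lt_nxt s; omega)] at this
  refine ⟨fun i j => y (Nat.pair i j), fun i => ⟨?_, ?_⟩, ?_⟩
  · intro a b hab
    exact (Nat.pair_eq_pair.1 (hyinj _ _ hab)).2
  · intro j
    have := hyadj (Nat.pair i j)
    simpa [nxt] using this
  · intro i j hij
    rw [Set.disjoint_left]
    rintro _ ⟨a, rfl⟩ ⟨b, hb⟩
    exact hij (Nat.pair_eq_pair.1 (hyinj _ _ hb)).1.symm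

open Classical in
lemma dominated_case (hω : IsRay G ω) (hdom : ∀ A B, Sp G ω A B → ∀ v, v ∈ B) :
    ∃ f : ℕ → ℕ → V, (∀ i, IsRay G (f i)) ∧ DisjointRays f := by
  have : Infinite V := Infinite.of_injective ω hω.1
  refine many_rays (fun T X => Disjoint T X) (ω 0) (by simp) ?_ ?_
  · intro T X x hTX hx
    by_contra hno
    have hN : ∀ y, G.Adj x y → y ∈ (↑(T ∪ X) : Set V) := by
      intro y hy
      by_contra hy2
      apply hno
      simp only [Finset.coe_union, mem_union, Finset.mem_coe, not_or] at hy2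
      refine ⟨y, hy, hy2.1, hy2.2, ?_⟩
      rw [Finset.disjoint_left] at *
      intro a ha hb
      simp only [Finset.mem_insert, Finset.mem_erase] at ha hb
      rcases ha with rfl | ha <;> rcases hb with rfl | hb
      · exact G.loopless.irrefl _ hy
      · exact hb.1 rfl
      · exact hy2.1 ha
      · exact hTX ha hb.2
    have h := (Sp.triv G ω (T ∪ X).finite_toSet).remove hω (c := x) (by simp [hx]) hN
    exact (hdom _ _ h x).2 rfl
  · intro T X hTX
    obtain ⟨y, hy⟩ := Infinite.exists_notMem_finset (T ∪ X)
    simp only [Finset.mem_union, not_or] at hy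
    exact ⟨y, hy.1, hy.2, by simpa [hTX] using hy.1⟩

lemma finite_cover (hU : ∀ v, ∃ A B, Sp G ω A B ∧ v ∉ B) {X : Set V} (hX : X.Finite) :
    ∃ A B, Sp G ω A B ∧ ∀ x ∈ X, x ∉ B := by
  induction X, hX using Set.Finite.induction_on with
  | empty => exact ⟨∅, univ, Sp.triv G ω finite_empty, by simp⟩
  | insert _ _ ih =>
    rename_i a s _ _
    obtain ⟨A, B, h, hB⟩ := ih
    obtain ⟨A', B', h', hB'⟩ := hU a
    refine ⟨_, _, h.union h', ?_⟩
    rintro x (rfl | hx) hh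
    · exact hB' hh.2
    · exact hB x hx hh.1

/-- expansion: a separation whose left side contains the closed neighbourhood -/
lemma expand (hU : ∀ v, ∃ A B, Sp G ω A B ∧ v ∉ B) {A B : Set V} (h : Sp G ω A B) :
    ∃ A' B', Sp G ω A' B' ∧ A ⊆ A' ∧ ∀ a ∈ A, ∀ y, G.Adj a y → y ∈ A' := by
  obtain ⟨C, D, h', hD⟩ := finite_cover hU h.fin
  refine ⟨_, _, h.union h', subset_union_left, fun a ha y hay => ?_⟩
  by_cases hB : a ∈ B
  · exact Or.inr (h'.adj a y hay (hD a ⟨ha, hB⟩))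
  · exact Or.inl (h.adj a y hay hB)

lemma closure_sep {X Y T A0 B0 : Set V} (hT : T.Finite) (h0 : Sp G ω A0 B0) (hX0 : X ⊆ A0)
    (hY0 : Y ⊆ A0) (n : ℕ)
    (hmin : ∀ A B, Sp G ω A B → X ⊆ A → n ≤ ((A ∩ B) \ T).ncard)
    (hbase : ∃ A B, Sp G ω A B ∧ X ⊆ A ∧ ((A ∩ B) \ T).ncard ≤ n)
    (hy : ∀ y ∈ Y, ∃ A B, Sp G ω A B ∧ X ⊆ A ∧ y ∈ A ∧ ((A ∩ B) \ T).ncard ≤ n) :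
    ∃ A B, Sp G ω A B ∧ X ⊆ A ∧ Y ⊆ A ∧ ((A ∩ B) \ T).ncard ≤ n := by
  classical
  have key : ∀ W : Finset V, ∃ A B, Sp G ω A B ∧ X ⊆ A ∧ ↑W ∩ Y ⊆ A ∧ ((A ∩ B) \ T).ncard ≤ n := by
    intro W
    induction W using Finset.induction_on with
    | empty =>
      obtain ⟨A, B, h, h1, h2⟩ := hbase
      exact ⟨A, B, h, h1, by simp, h2⟩
    | insert a W _ ih =>
      obtain ⟨A, B, h, h1, h2, h3⟩ := ih
      by_cases ha : a ∈ Y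
      · obtain ⟨C, D, h', h1', h2', h3'⟩ := hy a ha
        refine ⟨_, _, h.union h', h1.trans subset_union_left, ?_, ?_⟩
        · rintro x ⟨hx, hxY⟩
          rcases Finset.mem_insert.1 (Finset.mem_coe.1 hx) with rfl | hx
          · exact Or.inr h2'
          · exact Or.inl (h2 ⟨hx, hxY⟩)
        · have a := submod (T := T) h h'
          have b := hmin _ _ (h.inter h') (subset_inter h1 h1')
          omega
      · refine ⟨A, B, h, h1, ?_, h3⟩
        rintro x ⟨hx, hxY⟩
        rcases Finset.mem_insert.1 (Finset.mem_coe.1 hx) with rfl | hx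
        · exact (ha hxY).elim
        · exact h2 ⟨hx, hxY⟩
  obtain ⟨A, B, h, h1, h2⟩ := inf_sep (X := X ∪ Y) hT h0 (union_subset hX0 hY0) n (fun W => by
    obtain ⟨A, B, h, h1, h2, h3⟩ := key W
    refine ⟨A, B, h, ?_, h3⟩
    rintro x ⟨hxW, hx | hx⟩
    · exact h1 hx
    · exact h2 ⟨hxW, hx⟩)
  exact ⟨A, B, h, subset_union_left.trans h1, subset_union_right.trans h1, h2⟩

open Classical in
lemma unbounded_case (hω : IsRay G ω) (hU : ∀ v, ∃ A B, Sp G ω A B ∧ v ∉ B)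
    (hunb : ∀ n : ℕ, ∃ F : Finset V, ∀ A B, Sp G ω A B → ↑F ⊆ A → n < (A ∩ B).ncard) :
    ∃ f : ℕ → ℕ → V, (∀ i, IsRay G (f i)) ∧ DisjointRays f := by
  refine many_rays (fun T X => Disjoint T X ∧ ∀ A B, Sp G ω A B → (↑(T ∪ X) : Set V) ⊆ A →
    X.card ≤ ((A ∩ B) \ ↑T).ncard) (ω 0) (by simp) ?_ ?_
  · rintro T X x ⟨hTX, hL⟩ hx
    by_contra hno
    push Not at hno
    have hxT : x ∉ T := fun h => (Finset.disjoint_left.1 hTX h hx)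
    have hXc : 0 < X.card := Finset.card_pos.2 ⟨x, hx⟩
    have hfinT : (↑(insert x T) : Set V).Finite := Finset.finite_toSet _
    have hdiff : ∀ A B : Set V, (A ∩ B) \ (↑(insert x T) : Set V) = ((A ∩ B) \ ↑T) \ {x} := by
      intro A B; ext v; simp; tauto
    obtain ⟨A0, B0, h0, hB0⟩ := finite_cover hU (T ∪ X).finite_toSet
    have hA0 : (↑(T ∪ X) : Set V) ⊆ A0 := fun v hv => (h0.cov v).resolve_right (hB0 v hv)
    have hbase : ∃ A B, Sp G ω A B ∧ (↑(T ∪ X) : Set V) ⊆ A ∧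
        ((A ∩ B) \ (↑(insert x T) : Set V)).ncard ≤ X.card - 1 := by
      refine ⟨_, _, Sp.triv G ω (T ∪ X).finite_toSet, subset_rfl, ?_⟩
      rw [← Finset.card_erase_of_mem hx, ← ncard_coe_finset]
      refine ncard_le_ncard ?_ (Finset.finite_toSet _)
      intro v hv
      simp at hv ⊢
      tauto
    obtain ⟨A, B, h, h1, h2, h3⟩ := closure_sep (X := ↑(T ∪ X)) (Y := {y | G.Adj x y})
      (T := ↑(insert x T)) (A0 := A0) (B0 := B0) hfinT h0 hA0
      (fun y hy => h0.adj x y hy (hB0 x (by simp [hx]))) (X.card - 1)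
      (by
        intro A B h hA
        have := hL A B h hA
        rw [hdiff]
        have := pred_ncard_le_ncard_sdiff_singleton ((A ∩ B) \ ↑T) x
        omega)
      hbase
      (by
        intro y hy
        by_cases hyX : y ∈ T ∪ X
        · obtain ⟨A, B, h, h1, h2⟩ := hbase
          exact ⟨A, B, h, h1, h1 hyX, h2⟩
        · simp only [Finset.mem_union, not_or] at hyX
          have hyx : y ≠ x := fun h => hyX.2 (h ▸ hx)
          have hd : Disjoint (insert x T) (insert y (X.erase x)) := by
            rw [Finset.disjoint_left] at *
            intro a ha hb
            simp only [Finset.mem_insert, Finset.mem_erase] at ha hb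
            rcases ha with rfl | ha <;> rcases hb with rfl | hb
            · exact hyx rfl
            · exact hb.1 rfl
            · exact hyX.1 ha
            · exact hTX ha hb.2
          obtain ⟨A, B, h, h1, h2⟩ := hno y hy hyX.1 hyX.2 hd
          rw [Finset.card_insert_of_notMem (by simp [hyX.2]), Finset.card_erase_of_mem hx] at h2
          refine ⟨A, B, h, ?_, h1 (by simp), by omega⟩
          intro v hv
          apply h1
          simp at hv ⊢
          tauto)
    have hr := h.remove hω (c := x) (h1 (by simp [hx])) h2
    have h4 := hL _ _ hr h1
    have h5 : (A ∩ (B \ {x})) \ (↑T : Set V) = (A ∩ B) \ (↑(insert x T) : Set V) := by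
      ext v; simp; tauto
    rw [h5] at h4
    omega
  · rintro T X ⟨hTX, hL⟩
    by_contra hno
    push Not at hno
    obtain ⟨F, hF⟩ := hunb (X.card + T.card)
    obtain ⟨A0, B0, h0, hB0⟩ := finite_cover hU (T ∪ X ∪ F).finite_toSet
    have hA0 : (↑(T ∪ X ∪ F) : Set V) ⊆ A0 := fun v hv => (h0.cov v).resolve_right (hB0 v hv)
    have hbase : ∃ A B, Sp G ω A B ∧ (↑(T ∪ X) : Set V) ⊆ A ∧
        ((A ∩ B) \ (↑T : Set V)).ncard ≤ X.card := by
      refine ⟨_, _, Sp.triv G ω (T ∪ X).finite_toSet, subset_rfl, ?_⟩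
      rw [← ncard_coe_finset]
      refine ncard_le_ncard ?_ (Finset.finite_toSet _)
      intro v hv
      simp at hv ⊢
      tauto
    obtain ⟨A, B, h, h1, h2, h3⟩ := closure_sep (X := ↑(T ∪ X)) (Y := ↑F)
      (T := ↑T) (A0 := A0) (B0 := B0) T.finite_toSet h0
      (fun v hv => hA0 (by simp at hv ⊢; tauto)) (fun v hv => hA0 (by simp at hv ⊢; tauto)) X.card
      hL hbase
      (by
        intro y hy
        by_cases hyX : y ∈ T ∪ X
        · obtain ⟨A, B, h, h1, h2⟩ := hbase
          exact ⟨A, B, h, h1, h1 hyX, h2⟩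
        · simp only [Finset.mem_union, not_or] at hyX
          obtain ⟨A, B, h, h1, h2⟩ := hno y hyX.1 hyX.2 (by simp [hTX, hyX.1])
          rw [Finset.card_insert_of_notMem hyX.2] at h2
          refine ⟨A, B, h, ?_, h1 (by simp), by omega⟩
          intro v hv
          apply h1
          simp at hv ⊢
          tauto)
    have h4 := hF A B h h2
    have h5 := le_ncard_sdiff (↑T : Set V) (A ∩ B) T.finite_toSet
    rw [ncard_coe_finset] at h5
    omega

end rays


section bounded

variable {V : Type} {G : SimpleGraph V} {ω : ℕ → V}

lemma ray_of_walk (w : ℕ → V) (hadj : ∀ n, G.Adj (w n) (w (n + 1)))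
    (hfin : ∀ v, {n | w n = v}.Finite) : ∃ t : ℕ → ℕ, StrictMono t ∧ IsRay G (fun n => w (t n)) := by
  have hl : ∀ n, ∃ l, n ≤ l ∧ w l = w n ∧ ∀ m, l < m → w m ≠ w n := by
    intro n
    obtain ⟨l, hl, hmax⟩ := (hfin (w n)).exists_maximal ⟨n, rfl⟩
    refine ⟨l, ?_, hl, ?_⟩
    · by_contra hlt
      have := @hmax n rfl (by show l ≤ n; omega)
      have : n ≤ l := this
      omega
    · intro m hm hw
      have : m ≤ l := @hmax m hw hm.le
      omega
  choose l h1 h2 h3 using hl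
  let t : ℕ → ℕ := fun n => Nat.rec (l 0) (fun _ k => l (k + 1)) n
  have ts : ∀ n, t (n + 1) = l (t n + 1) := fun n => rfl
  have hmono : StrictMono t := strictMono_nat_of_lt_succ (fun n => by
    rw [ts]; have := h1 (t n + 1); omega)
  have hlast : ∀ n m, t n < m → w m ≠ w (t n) := by
    intro n m hm
    cases n with
    | zero => 
      have := h3 0 m hm
      rw [← h2 0] at this
      exact this
    | succ n =>
      rw [ts] at hm ⊢
      rw [h2]
      exact h3 _ _ hm
  refine ⟨t, hmono, ?_, ?_⟩
  · intro a b hab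
    by_contra hne
    rcases lt_or_gt_of_ne hne with h | h
    · exact hlast a _ (hmono h) hab.symm
    · exact hlast b _ (hmono h) hab
  · intro n
    show G.Adj (w (t n)) (w (t (n + 1)))
    rw [ts, h2]
    exact hadj _

lemma descending (hω : IsRay G ω) (hone : OneEnded G) (hc : ∀ u v, Nonempty (G.Walk u v))
    {M D : Set V} (h : Sp G ω M D) (hne : M.Nonempty) (φ : G ≃g G) (hφ : ∀ v ∈ M, φ v ∉ D) :
    False := by
  have hstep : ∀ v ∈ M, φ v ∈ M := fun v hv => (h.cov _).resolve_right (hφ v hv)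
  have hit : ∀ n v, v ∈ M → φ^[n] v ∈ M := by
    intro n
    induction n with
    | zero => exact fun v hv => hv
    | succ n ih => intro v hv; rw [Function.iterate_succ_apply']; exact hstep _ (ih v hv)
  have hadjn : ∀ n a b, G.Adj (φ^[n] a) (φ^[n] b) ↔ G.Adj a b := by
    intro n
    induction n with
    | zero => intros; rfl
    | succ n ih =>
      intro a b; rw [Function.iterate_succ_apply, Function.iterate_succ_apply, ih]
      exact φ.map_rel_iff
  have hinj : ∀ n, Function.Injective (φ^[n]) := fun n => φ.injective.iterate n
  have hsurj : ∀ n, Function.Surjective (φ^[n]) := fun n => φ.surjective.iterate n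
  have hi : ∀ y, ∃ n, φ^[n] y ∈ M := by
    obtain ⟨x, hx⟩ := hne
    refine closed_univ hc (x := x) ⟨0, hx⟩ ?_
    rintro a b hab ⟨n, hn⟩
    refine ⟨n + 1, h.adj (φ^[n+1] a) _ ((hadjn _ _ _).2 hab) ?_⟩
    rw [Function.iterate_succ_apply']
    exact hφ _ hn
  have hi' : ∀ y, ∃ N, ∀ n, N ≤ n → φ^[n] y ∈ M := by
    intro y
    obtain ⟨N, hN⟩ := hi y
    refine ⟨N, fun n hn => ?_⟩
    obtain ⟨d, rfl⟩ := Nat.exists_eq_add_of_le' hn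
    rw [Function.iterate_add_apply]
    exact hit _ _ hN
  have hii : ∀ y, ∃ N, ∀ n, N ≤ n → ∀ z, φ^[n] z = y → z ∉ M := by
    obtain ⟨m, hm⟩ := h.tail' hω
    refine closed_univ hc (x := ω m) ⟨0, ?_⟩ ?_
    · intro n _ z hz hzM
      exact hm m le_rfl (hz ▸ hit n z hzM)
    · rintro a b hab ⟨N, hN⟩
      refine ⟨N + 1, fun n hn z' hz' hM => ?_⟩
      obtain ⟨n, rfl⟩ : ∃ k, n = k + 1 := ⟨n - 1, by omega⟩
      obtain ⟨z, hz⟩ := hsurj n a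
      refine hN n (by omega) z hz ?_
      rw [Function.iterate_succ_apply] at hz'
      have : G.Adj (φ z') z := by
        rw [← hadjn n, hz, hz']; exact hab.symm
      exact h.adj _ _ this (hφ _ hM)
  have hiii : ∀ p m, 0 < m → φ^[m] p ≠ p := by
    intro p m hm hp
    obtain ⟨N, hN⟩ := hi' p
    obtain ⟨N', hN'⟩ := hii p
    have hper : ∀ j, φ^[m * j] p = p := by
      intro j
      have : Function.IsPeriodicPt φ m p := hp
      exact this.mul_const j
    have hle : ∀ j, j ≤ m * j := fun j => Nat.le_mul_of_pos_left j hm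
    have h1 := hN (m * N) (hle N)
    rw [hper] at h1
    exact hN' (m * N') (hle N') p (hper _) h1
  obtain ⟨x, hx⟩ := hne
  obtain ⟨P⟩ := hc x (φ x)
  have hL : 0 < P.length := by
    rcases Nat.eq_zero_or_pos P.length with h0 | h0
    · exact (hiii x 1 one_pos (SimpleGraph.Walk.eq_of_length_eq_zero h0).symm).elim
    · exact h0
  set L := P.length with hLdef
  let w : ℕ → V := fun n => φ^[n / L] (P.getVert (n % L))
  have hwadj : ∀ n, G.Adj (w n) (w (n + 1)) := by
    intro n
    have hr : n % L < L := Nat.mod_lt _ hL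
    have hP := P.adj_getVert_succ hr
    by_cases hlt : n % L + 1 < L
    · have e1 : (n + 1) / L = n / L := by
        rw [Nat.succ_div, if_neg]
        · rfl
        · intro hd
          have := Nat.mod_eq_zero_of_dvd hd
          rw [Nat.add_mod, Nat.mod_eq_of_lt (show 1 < L by omega), Nat.mod_eq_of_lt hlt] at this
          omega
      have e2 : (n + 1) % L = n % L + 1 := by
        rw [Nat.add_mod, Nat.mod_eq_of_lt (show 1 < L by omega), Nat.mod_eq_of_lt hlt]
      show G.Adj (φ^[n / L] _) (φ^[(n + 1) / L] (P.getVert ((n + 1) % L)))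
      rw [e1, e2, hadjn]
      exact hP
    · have e0 : n % L + 1 = L := by omega
      have hd : L ∣ n + 1 := by
        refine ⟨n / L + 1, ?_⟩
        have := Nat.div_add_mod n L
        rw [mul_add]; omega
      have e1 : (n + 1) / L = n / L + 1 := by rw [Nat.succ_div, if_pos hd]
      have e2 : (n + 1) % L = 0 := Nat.mod_eq_zero_of_dvd hd
      show G.Adj (φ^[n / L] _) (φ^[(n + 1) / L] (P.getVert ((n + 1) % L)))
      rw [e1, e2, Function.iterate_succ_apply, hadjn, P.getVert_zero]
      rw [e0, hLdef, P.getVert_length] at hP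
      exact hP
  have hmod : ∀ a b, w a = w b → a % L = b % L → a / L < b / L → False := by
    intro a b hab he hlt
    obtain ⟨d, hd⟩ := Nat.exists_eq_add_of_lt hlt
    have hab : φ^[a / L] (P.getVert (a % L)) = φ^[b / L] (P.getVert (b % L)) := hab
    rw [he, hd, add_assoc, Function.iterate_add_apply] at hab
    exact hiii _ (d + 1) (by omega) (hinj _ hab).symm
  obtain ⟨t, ht, hray⟩ := ray_of_walk w hwadj (by
    intro v
    refine Set.Finite.of_finite_image (f := fun n => n % L) ((finite_lt_nat L).subset ?_) ?_
    · rintro _ ⟨n, -, rfl⟩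
      exact Nat.mod_lt _ hL
    · intro a ha b hb hab
      have hab : a % L = b % L := hab
      have hw : w a = w b := by rw [show w a = v from ha, show w b = v from hb]
      rcases lt_trichotomy (a / L) (b / L) with h1 | h1 | h1
      · exact (hmod a b hw hab h1).elim
      · rw [← Nat.div_add_mod a L, ← Nat.div_add_mod b L, hab, h1]
      · exact (hmod b a hw.symm hab.symm h1).elim)
  choose N hN using hi'
  obtain ⟨m, hm⟩ := h.ray hω hone hray
  let K := (Finset.range L).sup (fun r => N (P.getVert r))
  have hK : ∀ n, L * K ≤ n → w n ∈ M := by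
    intro n hn
    refine hN _ _ (le_trans (Finset.le_sup (f := fun r => N (P.getVert r))
      (Finset.mem_range.2 (Nat.mod_lt n hL))) ?_)
    rw [Nat.le_div_iff_mul_le hL, mul_comm]
    exact hn
  refine hm (max m (L * K)) (le_max_left _ _) (hK _ ?_)
  exact (le_max_right _ _).trans (ht.id_le _)

end bounded

section bounded2

variable {V : Type} {G : SimpleGraph V} {ω : ℕ → V}

lemma far_one (hc : ∀ u v, Nonempty (G.Walk u v)) (hU : ∀ v, ∃ A B, Sp G ω A B ∧ v ∉ B)
    (o f : V) {C D : Set V} (h : Sp G ω C D) :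
    ∃ C' D', Sp G ω C' D' ∧ ∀ φ : G ≃g G, φ o ∉ C' → φ f ∉ C := by
  obtain ⟨w⟩ := hc o f
  induction w with
  | nil => exact ⟨C, D, h, fun φ hφ => hφ⟩
  | cons huv p ih =>
    obtain ⟨C1, D1, h1, hC1⟩ := ih
    obtain ⟨C', D', h', -, hN⟩ := expand hU h1
    refine ⟨C', D', h', fun φ hφ => hC1 φ fun hv => hφ (hN _ hv _ ?_)⟩
    exact φ.map_rel_iff.2 huv.symm

open Classical in
lemma far (hc : ∀ u v, Nonempty (G.Walk u v)) (hU : ∀ v, ∃ A B, Sp G ω A B ∧ v ∉ B)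
    (o : V) (F : Finset V) {C D : Set V} (h : Sp G ω C D) :
    ∃ C' D', Sp G ω C' D' ∧ ∀ φ : G ≃g G, φ o ∉ C' → ∀ f ∈ F, φ f ∉ C := by
  induction F using Finset.induction_on with
  | empty => exact ⟨C, D, h, fun φ _ f hf => by simp at hf⟩
  | insert a s _ ih =>
    obtain ⟨C1, D1, h1, hC1⟩ := ih
    obtain ⟨C2, D2, h2, hC2⟩ := far_one hc hU o a h
    refine ⟨_, _, h1.union h2, fun φ hφ f hf => ?_⟩
    rcases Finset.mem_insert.1 hf with rfl | hf
    · exact hC2 φ (fun h => hφ (Or.inr h))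
    · exact hC1 φ (fun h => hφ (Or.inl h)) f hf

open Classical in
lemma starset (hc : ∀ u v, Nonempty (G.Walk u v)) (o : V) (F : Finset V) :
    ∃ Z : Finset V, F ⊆ Z ∧ o ∈ Z ∧ ∀ z ∈ Z, ∃ w : G.Walk o z, ∀ v ∈ w.support, v ∈ Z := by
  refine ⟨insert o (F.biUnion fun f => (hc o f).some.support.toFinset), ?_, by simp, ?_⟩
  · intro f hf
    refine Finset.mem_insert_of_mem (Finset.mem_biUnion.2 ⟨f, hf, ?_⟩)
    simp
  · intro z hz
    rcases Finset.mem_insert.1 hz with rfl | hz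
    · exact ⟨.nil, by simp⟩
    · obtain ⟨f, hf, hz⟩ := Finset.mem_biUnion.1 hz
      have hz : z ∈ (hc o f).some.support := by simpa using hz
      refine ⟨(hc o f).some.takeUntil z hz, fun v hv => ?_⟩
      refine Finset.mem_insert_of_mem (Finset.mem_biUnion.2 ⟨f, hf, ?_⟩)
      simpa using SimpleGraph.Walk.support_takeUntil_subset _ hz hv

lemma star_side {o : V} {Z : Finset V}
    (hZ : ∀ z ∈ Z, ∃ w : G.Walk o z, ∀ v ∈ w.support, v ∈ Z) {C D : Set V} (h : Sp G ω C D)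
    (φ : G ≃g G) (hmiss : ∀ z ∈ Z, φ z ∉ C ∩ D) :
    (∀ z ∈ Z, φ z ∈ C) ∨ (∀ z ∈ Z, φ z ∈ D) := by
  by_cases ho : φ o ∈ C
  · by_cases hoD : φ o ∈ D
    · left
      intro z hz
      obtain ⟨w, hw⟩ := hZ z hz
      exact (hmiss o (hw o (by simp)) ⟨ho, hoD⟩).elim
    · left
      intro z hz
      obtain ⟨w, hw⟩ := hZ z hz
      have := walk_side (A := φ ⁻¹' D) (B := φ ⁻¹' C)
        (fun a b hab ha => h.adj _ _ (φ.map_rel_iff.2 hab) ha) w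
        (fun v hv hh => hmiss v (hw v hv) ⟨hh.2, hh.1⟩) hoD
      exact (h.cov _).resolve_right this
  · right
    intro z hz
    obtain ⟨w, hw⟩ := hZ z hz
    have := walk_side (A := φ ⁻¹' C) (B := φ ⁻¹' D)
      (fun a b hab ha => h.adj' (φ.map_rel_iff.2 hab) ha) w
      (fun v hv hh => hmiss v (hw v hv) ⟨hh.1, hh.2⟩) ho
    exact (h.cov _).resolve_left this

lemma disjoint_translates (htrans : ∀ u v : V, ∃ φ : G ≃g G, φ u = v) (hω : IsRay G ω)
    (hc : ∀ u v, Nonempty (G.Walk u v)) (hU : ∀ v, ∃ A B, Sp G ω A B ∧ v ∉ B) (Z : Finset V) :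
    ∃ ψ : ℕ → (G ≃g G), ∀ i j, i < j → ∀ a ∈ Z, ∀ b ∈ Z, ψ i a ≠ ψ j b := by
  obtain ⟨ψ, -, hψ⟩ := exists_seq_of_forall_finset_exists (fun _ : G ≃g G => True)
    (fun φ χ => ∀ a ∈ Z, ∀ b ∈ Z, φ a ≠ χ b) (fun s _ => by
      have hE : (⋃ φ ∈ s, (fun a => φ a) '' (Z : Set V)).Finite :=
        s.finite_toSet.biUnion (fun φ _ => Z.finite_toSet.image _)
      obtain ⟨C', D', h', hC'⟩ := far hc hU (ω 0) Z (Sp.triv G ω hE)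
      obtain ⟨m, hm⟩ := h'.tail' hω
      obtain ⟨χ, hχ⟩ := htrans (ω 0) (ω m)
      refine ⟨χ, trivial, fun φ hφ a ha b hb hab => ?_⟩
      refine hC' χ (by rw [hχ]; exact hm m le_rfl) b hb ?_
      rw [← hab]
      exact mem_biUnion (Finset.mem_coe.2 hφ) ⟨a, ha, rfl⟩)
  exact ⟨ψ, hψ⟩

lemma pigeon {Z : Finset V} {ψ : ℕ → (G ≃g G)}
    (hψ : ∀ i j, i < j → ∀ a ∈ Z, ∀ b ∈ Z, ψ i a ≠ ψ j b) {S : Set V} (hS : S.Finite) {k : ℕ}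
    (hk : S.ncard ≤ k) : ∃ i, i ≤ k ∧ ∀ z ∈ Z, ψ i z ∉ S := by
  by_contra hcon
  push Not at hcon
  haveI : Nonempty V := ⟨(hcon 0 (Nat.zero_le _)).choose⟩
  choose! z hz hzS using hcon
  have h1 : ((fun i => ψ i (z i)) '' (Iic k)).ncard = k + 1 := by
    rw [InjOn.ncard_image]
    · rw [← Nat.card_coe_set_eq]; simp
    · intro i hi j hj hij
      by_contra hne
      rcases lt_or_gt_of_ne hne with hlt | hlt
      · exact hψ i j hlt _ (hz i hi) _ (hz j hj) hij
      · exact hψ j i hlt _ (hz j hj) _ (hz i hi) hij.symm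
  have h2 : ((fun i => ψ i (z i)) '' (Iic k)).ncard ≤ S.ncard := by
    refine ncard_le_ncard ?_ hS
    rintro _ ⟨i, hi, rfl⟩
    exact hzS i hi
  omega

/-- Automorphisms reachable from the identity by multiplying with `h s`, `s ∈ S`. -/
inductive HReach (h : V → (G ≃g G)) (S : Set V) : (G ≃g G) → Prop
  | one : HReach h S (RelIso.refl _)
  | step (g : G ≃g G) (s : V) : HReach h S g → s ∈ S → HReach h S ((h s).trans g)

lemma reach_out (hω : IsRay G ω) (hone : OneEnded G) (hc : ∀ u v, Nonempty (G.Walk u v))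
    {o : V} {h : V → (G ≃g G)} (hh : ∀ v, h v o = v) {A B C D : Set V} (hAB : Sp G ω A B)
    (ho : o ∉ B) (hCD : Sp G ω C D) : ∃ g, HReach h (A ∩ B) g ∧ g o ∉ C := by
  by_contra hcon
  push Not at hcon
  have hP : ∀ y, ∃ g, HReach h (A ∩ B) g ∧ g.symm y ∈ A := by
    refine closed_univ hc (x := o) ⟨_, .one, (hAB.cov o).resolve_right ho⟩ ?_
    rintro p y hpy ⟨g, hg, hp⟩
    by_cases hpB : g.symm p ∈ B
    · refine ⟨_, .step g (g.symm p) hg ⟨hp, hpB⟩, ?_⟩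
      set s := g.symm p with hs
      refine hAB.adj o _ ?_ ho
      rw [← ((h s).trans g).map_rel_iff]
      show G.Adj (g (h s o)) (((h s).trans g) (((h s).trans g).symm y))
      rw [hh, RelIso.apply_symm_apply, hs, RelIso.apply_symm_apply]
      exact hpy
    · exact ⟨g, hg, hAB.adj _ _ (g.symm.map_rel_iff.2 hpy) hpB⟩
  obtain ⟨m, hm⟩ := hCD.tail' hω
  obtain ⟨g, hg, hgA⟩ := hP (ω m)
  have h' := hAB.preim hω hone g.symm
  have hmiss : ∀ n, m ≤ n → ¬ (ω n ∈ g.symm ⁻¹' B ∧ ω n ∈ g.symm ⁻¹' A) := by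
    rintro n hn ⟨h1, h2⟩
    have := hcon _ (.step g (g.symm (ω n)) hg ⟨h2, h1⟩)
    have e : ((h (g.symm (ω n))).trans g) o = ω n := by
      show g (h (g.symm (ω n)) o) = ω n
      rw [hh, RelIso.apply_symm_apply]
    rw [e] at this
    exact hm n hn this
  have := tail_side (A := g.symm ⁻¹' B) (B := g.symm ⁻¹' A) h'.adj hω.2 hmiss
    (fun hB => hmiss m le_rfl ⟨hB, hgA⟩)
  obtain ⟨m', hm'⟩ := h'.tail
  exact this (max m m') (le_max_left _ _) (hm' _ (le_max_right _ _))

open Classical in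
lemma link (hω : IsRay G ω) {Z Z' : Set V} {k : ℕ}
    (hZ : ∀ A B, Sp G ω A B → Z ⊆ A → k ≤ (A ∩ B).ncard)
    (hZ' : ∀ A B, Sp G ω A B → Z' ⊆ A → k ≤ (A ∩ B).ncard) :
    ∃ W : Finset V, ∀ C D, Sp G ω C D → Z ⊆ C → Z' ⊆ D → (C ∩ D).ncard ≤ k → C ∩ D ⊆ W := by
  by_contra hcon
  have key : ∀ W : Finset V, ∃ C D : Set V, (∀ z ∈ W, z ∈ Z → z ∈ C) ∧ (∀ z ∈ W, z ∈ Z' → z ∈ D) ∧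
      (∀ v ∈ W, v ∈ C ∨ v ∈ D) ∧ (∀ a ∈ W, ∀ b ∈ W, G.Adj a b → a ∉ D → b ∈ C) ∧
      (C ∩ D).Finite ∧ (C ∩ D).ncard < k := by
    intro W
    by_contra hW
    refine hcon ⟨W, fun C D h h1 h2 h3 => ?_⟩
    by_contra hsub
    refine hW ⟨C ∩ W, D ∩ W, fun z hz hz' => ⟨h1 hz', hz⟩, fun z hz hz' => ⟨h2 hz', hz⟩,
      fun v hv => ?_, fun a ha b hb hab hD => ⟨h.adj a b hab fun hh => hD ⟨hh, ha⟩, hb⟩, ?_, ?_⟩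
    · rcases h.cov v with hh | hh
      · exact Or.inl ⟨hh, hv⟩
      · exact Or.inr ⟨hh, hv⟩
    · exact h.fin.subset (fun x hx => ⟨hx.1.1, hx.2.1⟩)
    · refine lt_of_lt_of_le (ncard_lt_ncard ?_ h.fin) h3
      refine ⟨fun x hx => ⟨hx.1.1, hx.2.1⟩, fun hs => hsub fun x hx => (hs hx).1.2⟩
  choose C D h1 h2 h3 h4 h5 h6 using key
  let U : Ultrafilter (Finset V) := Ultrafilter.of Filter.atTop
  have hU : (U : Filter (Finset V)) ≤ Filter.atTop := Ultrafilter.of_le _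
  have hev : ∀ x, ∀ᶠ W : Finset V in U, x ∈ W := by
    intro x
    apply hU
    filter_upwards [Filter.eventually_ge_atTop ({x} : Finset V)] with W hW
    exact hW (Finset.mem_singleton_self x)
  obtain ⟨c1, c2, c3⟩ := limit_sep (G := G) U C D ∅ (k - 1)
    (fun v => by filter_upwards [hev v] with W hW using h3 W v hW)
    (fun a b hab => by filter_upwards [hev a, hev b] with W ha hb using h4 W a ha b hb hab)
    (Filter.Eventually.of_forall fun i => by
      rw [sdiff_empty, ← (h5 i).cast_ncard_eq]
      have := h6 i
      exact_mod_cast (by omega : (C i ∩ D i).ncard ≤ k - 1))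
  rw [sdiff_empty] at c3
  have hk : 0 < k := lt_of_le_of_lt (Nat.zero_le _) (h6 ∅)
  set C' : Set V := {v | ∀ᶠ i in U, v ∈ C i}
  set D' : Set V := {v | ∀ᶠ i in U, v ∈ D i}
  have hfin : (C' ∩ D').Finite := finite_of_encard_le_coe c3
  have hcard : (C' ∩ D').ncard ≤ k - 1 := by
    rw [← hfin.cast_ncard_eq] at c3
    exact_mod_cast c3
  have hZC : Z ⊆ C' := fun z hz => by
    show ∀ᶠ i in U, z ∈ C i
    filter_upwards [hev z] with W hW using h1 W z hW hz
  have hZD : Z' ⊆ D' := fun z hz => by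
    show ∀ᶠ i in U, z ∈ D i
    filter_upwards [hev z] with W hW using h2 W z hW hz
  obtain ⟨m, hm⟩ := inj_tail hω.1 hfin
  have c2' : ∀ a b, G.Adj a b → a ∉ C' → b ∈ D' := by
    intro a b hab ha
    by_contra hb
    exact ha (c2 b a hab.symm hb)
  by_cases hmC : ω m ∈ C'
  · have ht := tail_side (A := D') (B := C') c2 hω.2 (fun n hn hh => hm n hn ⟨hh.2, hh.1⟩)
      (fun hD => hm m le_rfl ⟨hmC, hD⟩)
    have hs : Sp G ω D' C' := ⟨fun v => (c1 v).symm, c2', by rwa [inter_comm],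
      m, fun n hn => (c1 _).resolve_right (ht n hn)⟩
    have := hZ' _ _ hs hZD
    rw [inter_comm] at this
    omega
  · have ht := tail_side (A := C') (B := D') c2' hω.2 (fun n hn hh => hm n hn hh) hmC
    have hs : Sp G ω C' D' := ⟨c1, c2, hfin, m, fun n hn => (c1 _).resolve_left (ht n hn)⟩
    have := hZ _ _ hs hZC
    omega

lemma big_image (hω : IsRay G ω) (hone : OneEnded G) {Z : Set V} {k : ℕ}
    (hZ : ∀ A B, Sp G ω A B → Z ⊆ A → k ≤ (A ∩ B).ncard) (φ : G ≃g G) :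
    ∀ A B, Sp G ω A B → φ '' Z ⊆ A → k ≤ (A ∩ B).ncard := by
  intro A B h hs
  have := hZ _ _ (h.preim hω hone φ) (image_subset_iff.1 hs)
  rwa [← preimage_inter, ncard_preim] at this

open Classical in
lemma capture (htrans : ∀ u v : V, ∃ φ : G ≃g G, φ u = v) (hone : OneEnded G) (hω : IsRay G ω)
    (hc : ∀ u v, Nonempty (G.Walk u v)) (hU : ∀ v, ∃ A B, Sp G ω A B ∧ v ∉ B) {k : ℕ}
    {F0 : Finset V} (hF0 : ∀ A B, Sp G ω A B → ↑F0 ⊆ A → k ≤ (A ∩ B).ncard) :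
    ∃ (F : Finset V) (W : Set V), W.Finite ∧ F.Nonempty ∧
      (∀ A B, Sp G ω A B → ↑F ⊆ A → k ≤ (A ∩ B).ncard) ∧
      ∀ C D, Sp G ω C D → ↑F ⊆ C → (C ∩ D).ncard ≤ k → ∃ g : G ≃g G, g ⁻¹' (C ∩ D) ⊆ W := by
  obtain ⟨Z, hFZ, hoZ, hZ⟩ := starset hc (ω 0) F0
  have hZbig : ∀ A B, Sp G ω A B → (Z : Set V) ⊆ A → k ≤ (A ∩ B).ncard :=
    fun A B h hs => hF0 A B h ((Finset.coe_subset.2 hFZ).trans hs)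
  obtain ⟨ψ, hψ⟩ := disjoint_translates htrans hω hc hU Z
  choose h hh using htrans (ω 0)
  obtain ⟨A0, B0, h0, ho⟩ := hU (ω 0)
  let F : Finset V := (Finset.range (k + 1)).biUnion fun i => Z.image (ψ i)
  have hF : ∀ i, i ≤ k → ∀ z ∈ Z, ψ i z ∈ F := fun i hi z hz =>
    Finset.mem_biUnion.2 ⟨i, Finset.mem_range.2 (by omega), Finset.mem_image_of_mem _ hz⟩
  have hL : ∀ i j s, ∃ W : Finset V, ∀ C D, Sp G ω C D → (ψ i) '' (Z : Set V) ⊆ C →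
      ((ψ j).trans (h s)) '' (Z : Set V) ⊆ D → (C ∩ D).ncard ≤ k → C ∩ D ⊆ W := fun i j s =>
    link hω (big_image hω hone hZbig _) (big_image hω hone hZbig _)
  choose W hW using hL
  refine ⟨F, ⋃ i ∈ Iic k, ⋃ j ∈ Iic k, ⋃ s ∈ A0 ∩ B0, (W i j s : Set V), ?_,
    ⟨_, hF 0 (Nat.zero_le _) _ hoZ⟩, ?_, ?_⟩
  · exact (finite_Iic k).biUnion fun i _ => (finite_Iic k).biUnion fun j _ =>
      h0.fin.biUnion fun s _ => (W i j s).finite_toSet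
  · intro A B hAB hs
    refine big_image hω hone hZbig (ψ 0) A B hAB ?_
    rintro _ ⟨z, hz, rfl⟩
    exact hs (hF 0 (Nat.zero_le _) z hz)
  · intro C D hCD hFC hk
    have hside : ∀ g : G ≃g G, (∃ i, i ≤ k ∧ ∀ z ∈ Z, g (ψ i z) ∈ C) ∨
        (∃ i, i ≤ k ∧ ∀ z ∈ Z, g (ψ i z) ∈ D) := by
      intro g
      obtain ⟨i, hi, hmiss⟩ := pigeon hψ (k := k) (S := g ⁻¹' (C ∩ D))
        (hCD.fin.preimage g.injective.injOn) (by rwa [ncard_preim])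
      rcases star_side hZ hCD ((ψ i).trans g) hmiss with hh | hh
      · exact Or.inl ⟨i, hi, hh⟩
      · exact Or.inr ⟨i, hi, hh⟩
    have hind : ∀ g, HReach h (A0 ∩ B0) g → (∃ i, i ≤ k ∧ ∀ z ∈ Z, g (ψ i z) ∈ C) ∨
        ∃ (g : G ≃g G) (i j : ℕ) (s : V), i ≤ k ∧ j ≤ k ∧ s ∈ A0 ∩ B0 ∧ (∀ z ∈ Z, g (ψ i z) ∈ C) ∧
          (∀ z ∈ Z, g (h s (ψ j z)) ∈ D) := by
      intro g hg
      induction hg with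
      | one => exact Or.inl ⟨0, Nat.zero_le _, fun z hz => hFC (hF 0 (Nat.zero_le _) z hz)⟩
      | step g s hg hs ih =>
        rcases ih with ⟨i, hi, hiC⟩ | ih
        · rcases hside ((h s).trans g) with hh | ⟨j, hj, hjD⟩
          · exact Or.inl hh
          · exact Or.inr ⟨g, i, j, s, hi, hj, hs, hiC, hjD⟩
        · exact Or.inr ih
    obtain ⟨C', D', h', hC'⟩ := far hc hU (ω 0) F hCD
    obtain ⟨g, hg, hgo⟩ := reach_out hω hone hc hh h0 ho h'
    rcases hind g hg with ⟨i, hi, hiC⟩ | ⟨g, i, j, s, hi, hj, hs, hiC, hjD⟩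
    · exact (hC' g hgo _ (hF i hi _ hoZ) (hiC _ hoZ)).elim
    · refine ⟨g, ?_⟩
      have := hW i j s _ _ (hCD.preim hω hone g) (by
        rintro _ ⟨z, hz, rfl⟩
        exact hiC z hz) (by
        rintro _ ⟨z, hz, rfl⟩
        exact hjD z hz) (by rwa [← preimage_inter, ncard_preim])
      rw [preimage_inter]
      refine this.trans ?_
      intro x hx
      simp only [mem_iUnion]
      exact ⟨i, hi, j, hj, s, hs, hx⟩

/-- The union of all sides away from the end of separations whose separator lies in `S`. -/
def hull (G : SimpleGraph V) (ω : ℕ → V) (S : Set V) : Set V :=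
  {v | ∃ A B, Sp G ω A B ∧ A ∩ B ⊆ S ∧ v ∈ A}

lemma hull_preim (hω : IsRay G ω) (hone : OneEnded G) (φ : G ≃g G) (S : Set V) :
    φ ⁻¹' (hull G ω S) = hull G ω (φ ⁻¹' S) := by
  ext v
  constructor
  · rintro ⟨A, B, h, hs, hv⟩
    exact ⟨_, _, h.preim hω hone φ, fun x hx => hs hx, hv⟩
  · rintro ⟨A, B, h, hs, hv⟩
    refine ⟨_, _, h.preim hω hone φ.symm, fun x hx => ?_, ?_⟩
    · have := hs hx
      simpa using this
    · simpa using hv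

lemma hull_sp (hω : IsRay G ω) {C D : Set V} (h : Sp G ω C D) :
    Sp G ω (hull G ω (C ∩ D)) ((hull G ω (C ∩ D))ᶜ ∪ (C ∩ D)) ∧ C ⊆ hull G ω (C ∩ D) ∧
      hull G ω (C ∩ D) ∩ ((hull G ω (C ∩ D))ᶜ ∪ (C ∩ D)) = C ∩ D := by
  have hsub : C ⊆ hull G ω (C ∩ D) := fun v hv => ⟨C, D, h, Subset.rfl, hv⟩
  have heq : hull G ω (C ∩ D) ∩ ((hull G ω (C ∩ D))ᶜ ∪ (C ∩ D)) = C ∩ D := by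
    ext x
    constructor
    · rintro ⟨h1, h2 | h2⟩
      · exact (h2 h1).elim
      · exact h2
    · intro hx
      exact ⟨hsub hx.1, Or.inr hx⟩
  refine ⟨⟨fun v => ?_, fun a b hab ha => ?_, by rw [heq]; exact h.fin, ?_⟩, hsub, heq⟩
  · by_cases hv : v ∈ hull G ω (C ∩ D)
    · exact Or.inl hv
    · exact Or.inr (Or.inl hv)
  · have h1 : a ∈ hull G ω (C ∩ D) := by
      by_contra hh; exact ha (Or.inl hh)
    have h2 : a ∉ C ∩ D := fun hh => ha (Or.inr hh)
    obtain ⟨A, B, hAB, hs, haA⟩ := h1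
    exact ⟨A, B, hAB, hs, hAB.adj a b hab fun hB => h2 (hs ⟨haA, hB⟩)⟩
  · obtain ⟨m, hm⟩ := h.tail' hω
    refine ⟨m, fun n hn => Or.inl ?_⟩
    rintro ⟨A, B, hAB, hs, hA⟩
    have := tail_side (A := B) (B := A) hAB.adj hω.2 (m := n)
      (fun i hi hh => hm i (hn.trans hi) (hs ⟨hh.2, hh.1⟩).1)
      (fun hB => hm n hn (hs ⟨hA, hB⟩).1)
    obtain ⟨m', hm'⟩ := hAB.tail
    exact this (max n m') (le_max_left _ _) (hm' _ (le_max_right _ _))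

open Classical in
lemma bounded_case (htrans : ∀ u v : V, ∃ φ : G ≃g G, φ u = v) (hone : OneEnded G)
    (hω : IsRay G ω) (hU : ∀ v, ∃ A B, Sp G ω A B ∧ v ∉ B) {k : ℕ}
    (hb : ∀ F : Finset V, ∃ A B, Sp G ω A B ∧ ↑F ⊆ A ∧ (A ∩ B).ncard ≤ k)
    {F0 : Finset V} (hF0 : ∀ A B, Sp G ω A B → ↑F0 ⊆ A → k ≤ (A ∩ B).ncard) : False := by
  have hc := conn htrans hone hω
  obtain ⟨F, W, hWfin, ⟨f0, hf0⟩, hF, hcap⟩ := capture htrans hone hω hc hU hF0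
  obtain ⟨p, hp, hr⟩ := exists_seq_of_forall_finset_exists
    (fun p : Set V × Set V => Sp G ω p.1 p.2 ∧ ↑F ⊆ p.1 ∧ (p.1 ∩ p.2).ncard ≤ k ∧
      p.1 = hull G ω (p.1 ∩ p.2))
    (fun p q => ∀ v ∈ p.1, v ∉ q.2) (fun s hs => by
      have hun : ∃ A B, Sp G ω A B ∧ ↑F ⊆ A ∧ ∀ p ∈ s, p.1 ⊆ A := by
        induction s using Finset.induction_on with
        | empty => exact ⟨_, _, Sp.triv G ω F.finite_toSet, Subset.rfl, by simp⟩
        | insert a s _ ih =>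
          obtain ⟨A, B, h1, h2, h3⟩ := ih fun x hx => hs x (Finset.mem_insert_of_mem hx)
          have ha := (hs a (Finset.mem_insert_self _ _)).1
          refine ⟨_, _, h1.union ha, h2.trans subset_union_left, fun p hp => ?_⟩
          rcases Finset.mem_insert.1 hp with rfl | hp
          · exact subset_union_right
          · exact (h3 p hp).trans subset_union_left
      obtain ⟨A, B, hAB, hFA, hsA⟩ := hun
      obtain ⟨A', B', hAB', hAA', hN⟩ := expand hU hAB
      obtain ⟨C, D, hCD, hC, hk⟩ := inf_sep (X := A') finite_empty hAB' Subset.rfl k (fun T => by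
        obtain ⟨C, D, h1, h2, h3⟩ := hb T
        exact ⟨C, D, h1, inter_subset_left.trans h2, by rwa [sdiff_empty]⟩)
      rw [sdiff_empty] at hk
      obtain ⟨e1, e2, e3⟩ := hull_sp hω hCD
      refine ⟨(hull G ω (C ∩ D), (hull G ω (C ∩ D))ᶜ ∪ (C ∩ D)),
        ⟨e1, hFA.trans (hAA'.trans (hC.trans e2)), by rw [e3]; exact hk, by rw [e3]⟩, ?_⟩
      intro q hq v hv hvD
      have hvA := hsA q hq hv
      have hvC : v ∈ C := hC (hAA' hvA)
      have hvD : v ∈ D := by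
        rcases hvD with hh | hh
        · exact (hh (e2 hvC)).elim
        · exact hh.2
      have h1 := hCD.remove hω hvC fun y hy => hC (hN v hvA y hy)
      have h2 := hF _ _ h1 (hFA.trans (hAA'.trans hC))
      have h3 : (C ∩ (D \ {v})).ncard < (C ∩ D).ncard := by
        refine ncard_lt_ncard ⟨fun x hx => ⟨hx.1, hx.2.1⟩, fun hh => ?_⟩ hCD.fin
        exact (hh ⟨hvC, hvD⟩).2.2 rfl
      omega)
  choose g hg using fun i => hcap _ _ (hp i).1 (hp i).2.1 (hp i).2.2.1
  have hkey : ∀ i j, i < j → g i ⁻¹' ((p i).1 ∩ (p i).2) = g j ⁻¹' ((p j).1 ∩ (p j).2) → False := by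
    intro i j hij he
    have hpre : ((g j).symm.trans (g i)) ⁻¹' ((p i).1 ∩ (p i).2) = (p j).1 ∩ (p j).2 := by
      ext v
      show (g j).symm v ∈ g i ⁻¹' ((p i).1 ∩ (p i).2) ↔ _
      rw [he, mem_preimage, RelIso.apply_symm_apply]
    have hC : ((g j).symm.trans (g i)) ⁻¹' (p i).1 = (p j).1 := by
      rw [(hp i).2.2.2, hull_preim hω hone, hpre, ← (hp j).2.2.2]
    refine descending hω hone hc (hp j).1 ⟨f0, (hp j).2.1 hf0⟩ ((g j).symm.trans (g i)) ?_
    intro v hv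
    rw [← hC] at hv
    exact hr i j hij _ hv
  have hfin : Set.Finite {S : Set V | S ⊆ W} := hWfin.finite_subsets
  obtain ⟨i, -, j, -, hne, he⟩ := infinite_univ.exists_ne_map_eq_of_mapsTo
    (f := fun i : ℕ => g i ⁻¹' ((p i).1 ∩ (p i).2)) (t := {S : Set V | S ⊆ W})
    (fun i _ => hg i) hfin
  rcases lt_or_gt_of_ne hne with hlt | hlt
  · exact hkey i j hlt he
  · exact hkey j i hlt he.symm

end bounded2

/-- the unique end of a transitive one-ended graph has infinite vertex
degree: the graph contains an infinite family of pairwise disjoint rays in that end. -/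
theorem transitive_one_ended_infinite_disjoint_rays {V : Type} (G : SimpleGraph V)
    (htrans : ∀ u v : V, ∃ φ : G ≃g G, φ u = v)
    (hone : OneEnded G) (ω : ℕ → V) (hω : IsRay G ω) :
    ∃ f : ℕ → ℕ → V, (∀ i, InEnd G ω (f i)) ∧ DisjointRays f := by
  classical
  have fin : (∃ f : ℕ → ℕ → V, (∀ i, IsRay G (f i)) ∧ DisjointRays f) →
      ∃ f : ℕ → ℕ → V, (∀ i, InEnd G ω (f i)) ∧ DisjointRays f := by
    rintro ⟨f, hf, hd⟩
    exact ⟨f, fun i => ⟨hf i, hone.2 _ _ (hf i) hω⟩, hd⟩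
  apply fin
  by_cases hdom : ∀ A B, Sp G ω A B → ∀ v, v ∈ B
  · exact dominated_case hω hdom
  · push Not at hdom
    obtain ⟨A, B, h, u, hu⟩ := hdom
    have hU : ∀ v, ∃ A B, Sp G ω A B ∧ v ∉ B := by
      intro v
      obtain ⟨φ, hφ⟩ := htrans v u
      refine ⟨_, _, h.preim hω hone φ, ?_⟩
      rw [mem_preimage, hφ]
      exact hu
    by_cases hunb : ∀ n : ℕ, ∃ F : Finset V, ∀ A B, Sp G ω A B → ↑F ⊆ A → n < (A ∩ B).ncard
    · exact unbounded_case hω hU hunb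
    · exfalso
      have hex : ∃ n : ℕ, ∀ F : Finset V, ∃ A B, Sp G ω A B ∧ ↑F ⊆ A ∧ (A ∩ B).ncard ≤ n := by
        push Not at hunb
        exact hunb
      have hF0 : ∃ F0 : Finset V, ∀ A B, Sp G ω A B → ↑F0 ⊆ A → Nat.find hex ≤ (A ∩ B).ncard := by
        rcases Nat.eq_zero_or_pos (Nat.find hex) with h0 | h0
        · exact ⟨∅, fun _ _ _ _ => by omega⟩
        · have := Nat.find_min hex (m := Nat.find hex - 1) (by omega)
          push Not at this
          obtain ⟨F, hF⟩ := this
          exact ⟨F, fun A B h1 h2 => by have := hF A B h1 h2; omega⟩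
      obtain ⟨F0, hF0⟩ := hF0
      exact bounded_case htrans hone hω hU (Nat.find_spec hex) hF0

end PaperEnds
end

section
/- If G is a connected locally finite graph with exactly one end and linear growth, then the automorphism group of G is either finite or contains exactly 2^{ℵ₀} elements. -/
open Set Cardinal

namespace PaperEnds

section Helpers

open Filter SimpleGraph

variable {V : Type} {G : SimpleGraph V}

lemma iso_dist_le (hconn : G.Connected) (g : G ≃g G) (a b : V) :
    G.dist (g a) (g b) ≤ G.dist a b := by
  obtain ⟨p, hp⟩ := hconn.exists_walk_length_eq_dist a b
  rw [← hp, ← Walk.length_map g.toHom p]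
  exact dist_le _

lemma iso_dist (hconn : G.Connected) (g : G ≃g G) (a b : V) :
    G.dist (g a) (g b) = G.dist a b := by
  apply le_antisymm (iso_dist_le hconn g a b)
  have := iso_dist_le hconn g⁻¹ (g a) (g b)
  simpa [RelIso.inv_apply_self] using this

lemma adj_dist (hconn : G.Connected) (v : V) {a b : V} (h : G.Adj a b) :
    G.dist v b ≤ G.dist v a + 1 := by
  have h1 := hconn.dist_triangle (u := v) (v := a) (w := b)
  have h2 : G.dist a b = 1 := dist_eq_one_iff_adj.2 h
  omega

/-- geodesics as sequences -/
lemma geo (hconn : G.Connected) (v y : V) :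
    ∃ p : ℕ → V, p 0 = v ∧ p (G.dist v y) = y ∧ (∀ i ≤ G.dist v y, G.dist v (p i) = i) ∧
      ∀ i < G.dist v y, G.Adj (p i) (p (i + 1)) := by
  obtain ⟨w, hw⟩ := hconn.exists_walk_length_eq_dist v y
  refine ⟨w.getVert, w.getVert_zero, ?_, ?_, ?_⟩
  · rw [← hw, w.getVert_length]
  · intro i hi
    have h1 : G.dist v (w.getVert i) ≤ i := by
      refine (dist_le (w.take i)).trans ?_
      rw [Walk.take_length]; exact min_le_left _ _
    have h2 : G.dist (w.getVert i) y ≤ w.length - i := by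
      refine (dist_le (w.drop i)).trans ?_
      rw [Walk.drop_length]
    have h3 := hconn.dist_triangle (u := v) (v := w.getVert i) (w := y)
    omega
  · intro i hi
    exact w.adj_getVert_succ (by omega)

lemma ball_finite (hconn : G.Connected) (hlf : ∀ v : V, (G.neighborSet v).Finite) (v : V) (n : ℕ) :
    {u : V | G.dist v u ≤ n}.Finite := by
  induction n with
  | zero =>
    refine (Set.finite_singleton v).subset ?_
    intro u hu
    have : G.dist v u = 0 := by simpa using hu
    exact (hconn.dist_eq_zero_iff.1 this).symm
  | succ n ih =>
    refine (ih.union (ih.biUnion (fun u _ => hlf u))).subset ?_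
    intro u hu
    simp only [Set.mem_ofPred_eq] at hu
    by_cases h : G.dist v u ≤ n
    · left; exact h
    · right
      obtain ⟨p, p0, p1, p2, p3⟩ := geo hconn v u
      have hd : G.dist v u = n + 1 := by omega
      simp only [Set.mem_iUnion]
      refine ⟨p n, ?_, ?_⟩
      · simp only [Set.mem_ofPred_eq]; rw [p2 n (by omega)]
      · have := p3 n (by omega)
        rw [← hd, p1] at this
        exact this

lemma exists_far (hconn : G.Connected) (hlf : ∀ v : V, (G.neighborSet v).Finite) (v : V)
    {Q : Set V} (hQ : Q.Infinite) (n : ℕ) : ∃ y ∈ Q, n < G.dist v y := by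
  by_contra h
  push Not at h
  exact hQ ((ball_finite hconn hlf v n).subset h)

lemma finite_subset_ball (v : V) {F : Set V} (hF : F.Finite) :
    ∃ N, ∀ x ∈ F, G.dist v x ≤ N := by
  obtain ⟨N, hN⟩ := (hF.image (G.dist v)).bddAbove
  exact ⟨N, fun x hx => hN (Set.mem_image_of_mem _ hx)⟩

lemma infinite_of_dist (v : V) {Q : Set V} (N : ℕ) (h : ∀ m ≥ N, ∃ x ∈ Q, G.dist v x = m) :
    Q.Infinite := by
  intro hf
  obtain ⟨M, hM⟩ := finite_subset_ball (G := G) v hf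
  obtain ⟨x, hx, hd⟩ := h (max N (M + 1)) (le_max_left _ _)
  have := hM x hx
  have := le_max_right N (M + 1)
  omega

lemma uf_exists {α : Type} (U : Ultrafilter ℕ) {F : Set α} (hF : F.Finite) {Q : ℕ → α → Prop}
    (h : ∀ᶠ j in (U : Filter ℕ), ∃ x ∈ F, Q j x) : ∃ x ∈ F, ∀ᶠ j in (U : Filter ℕ), Q j x :=
  (Ultrafilter.eventually_exists_mem_iff hF).1 h

lemma hyper_ge (i : ℕ) : ∀ᶠ j in (hyperfilter ℕ : Filter ℕ), i ≤ j :=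
  Nat.hyperfilter_le_atTop (eventually_ge_atTop i)

/-- An infinite vertex set with finite inner boundary contains the tail of a geodesic ray. -/
lemma exists_ray (hconn : G.Connected) (hlf : ∀ v : V, (G.neighborSet v).Finite) (v : V)
    {Q : Set V} (hQ : Q.Infinite) (N : ℕ)
    (hN : ∀ u ∈ Q, ∀ w ∉ Q, G.Adj u w → G.dist v u ≤ N) :
    ∃ r : ℕ → V, IsRay G r ∧ (∀ i, G.dist v (r i) = i) ∧ ∀ i, N < i → r i ∈ Q := by
  have h1 : ∀ j : ℕ, ∃ p : ℕ → V, (∀ i ≤ j, G.dist v (p i) = i) ∧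
      (∀ i < j, G.Adj (p i) (p (i+1))) ∧ ∀ i ≤ j, N < i → p i ∈ Q := by
    intro j
    obtain ⟨y, hy, hjy⟩ := exists_far hconn hlf v hQ j
    obtain ⟨p, p0, p1, p2, p3⟩ := geo hconn v y
    refine ⟨p, fun i hi => p2 i (by omega), fun i hi => p3 i (by omega), ?_⟩
    have key : ∀ t, ∀ i, i + t = G.dist v y → N < i → p i ∈ Q := by
      intro t
      induction t with
      | zero => 
        intro i hi _
        rw [Nat.add_zero] at hi
        rw [hi, p1]; exact hy
      | succ t ih =>
        intro i hi hNi
        by_contra hc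
        have h1 := ih (i+1) (by omega) (by omega)
        have := hN _ h1 _ hc (p3 i (by omega)).symm
        rw [p2 (i+1) (by omega)] at this
        omega
    intro i hi hNi
    exact key (G.dist v y - i) i (by omega) hNi
  choose p hp1 hp2 hp3 using h1
  have h2 : ∀ i, ∃ x ∈ {u : V | G.dist v u ≤ i}, ∀ᶠ j in (hyperfilter ℕ : Filter ℕ), p j i = x := by
    intro i
    apply uf_exists _ (ball_finite hconn hlf v i)
    filter_upwards [hyper_ge i] with j hj
    exact ⟨p j i, (hp1 j i hj).le, rfl⟩
  choose r _ hr using h2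
  have hd : ∀ i, G.dist v (r i) = i := by
    intro i
    obtain ⟨j, hj, hj2⟩ := ((hr i).and (hyper_ge i)).exists
    rw [← hj]; exact hp1 j i hj2
  refine ⟨r, ⟨?_, ?_⟩, hd, ?_⟩
  · intro a b hab
    rw [← hd a, ← hd b, hab]
  · intro i
    obtain ⟨j, ⟨hj, hj1⟩, hj2⟩ := (((hr i).and (hr (i+1))).and (hyper_ge (i+1))).exists
    rw [← hj, ← hj1]; exact hp2 j i hj2
  · intro i hi
    obtain ⟨j, hj, hj2⟩ := ((hr i).and (hyper_ge i)).exists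
    rw [← hj]; exact hp3 j i hj2 hi

/-- In a one-ended graph no finite boundary separates two infinite sets. -/
lemma one_end_sep (hconn : G.Connected) (hlf : ∀ v : V, (G.neighborSet v).Finite)
    (hone : OneEnded G) {P : Set V} (hb : {u | u ∈ P ∧ ∃ w ∉ P, G.Adj u w}.Finite)
    (h1 : P.Infinite) (h2 : Pᶜ.Infinite) : False := by
  obtain ⟨v, -⟩ := h1.nonempty
  obtain ⟨N, hN⟩ := finite_subset_ball (G := G) v hb
  obtain ⟨r1, hr1, hd1, hP1⟩ := exists_ray hconn hlf v h1 (N+1) (fun u hu w hw ha =>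
    (hN u ⟨hu, w, hw, ha⟩).trans (by omega))
  obtain ⟨r2, hr2, hd2, hP2⟩ := exists_ray hconn hlf v h2 (N+1) (fun u hu w hw ha => by
    have hw' : w ∈ P := by simpa using hw
    have := hN w ⟨hw', u, hu, ha.symm⟩
    have := adj_dist hconn v ha.symm
    omega)
  obtain ⟨m, n, hm, hn, w, hw⟩ := hone.2 r1 r2 hr1 hr2 _ (ball_finite hconn hlf v (N+1))
  have hm' := hm m le_rfl
  have hn' := hn n le_rfl
  simp only [Set.mem_ofPred_eq, hd1, hd2] at hm' hn'
  obtain ⟨d, hd, hd3, hd4⟩ := w.exists_boundary_dart P (hP1 m (by omega)) (hP2 n (by omega))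
  have h5 := hN d.fst ⟨hd3, d.snd, hd4, d.adj⟩
  exact hw d.fst (w.dart_fst_mem_support_of_mem_darts hd) (by simp only [Set.mem_ofPred_eq]; omega)

/-- discrete intermediate value theorem along walks -/
lemma walk_ivt (hconn : G.Connected) (o : V) (m : ℕ) {a b : V} (w : G.Walk a b)
    (ha : G.dist o a ≤ m) (hb : m ≤ G.dist o b) : ∃ z ∈ w.support, G.dist o z = m := by
  induction w with
  | nil => exact ⟨_, by simp, le_antisymm ha hb⟩
  | @cons a c b h w ih =>
    by_cases hc : G.dist o a = m
    · exact ⟨a, by simp, hc⟩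
    · have := adj_dist hconn o h
      obtain ⟨z, hz, hz2⟩ := ih (by omega) hb
      exact ⟨z, by simp [hz], hz2⟩

lemma exists_comp (hconn : G.Connected) (hlf : ∀ v : V, (G.neighborSet v).Finite)
    (hone : OneEnded G) (v : V) (n : ℕ) :
    ∃ C : Set V, (∀ u ∈ C, n < G.dist v u) ∧
      (∀ u ∈ C, ∀ w ∉ C, G.Adj u w → G.dist v w = n ∧ G.dist v u = n + 1) ∧
      Cᶜ.Finite ∧
      ∀ x ∈ C, ∀ (o : V) (M : ℕ), ∃ y, M ≤ G.dist o y ∧ ∃ w : G.Walk x y, ∀ z ∈ w.support, z ∈ C := by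
  classical
  obtain ⟨r0, hr0⟩ := hone.1
  have hinf : (Set.univ : Set V).Infinite := by
    have := Infinite.of_injective r0 hr0.1
    exact Set.infinite_univ
  obtain ⟨r, hr, hd, -⟩ := exists_ray hconn hlf v hinf 0 (fun u _ w hw => absurd (Set.mem_univ w) hw)
  let C : Set V := {u | ∃ p : G.Walk u (r (n+1)), ∀ z ∈ p.support, n < G.dist v z}
  have hC1 : ∀ u ∈ C, n < G.dist v u := by
    rintro u ⟨p, hp⟩
    exact hp u (by simp)
  have hC2 : ∀ u ∈ C, ∀ w ∉ C, G.Adj u w → G.dist v w = n ∧ G.dist v u = n + 1 := by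
    intro u hu w hw ha
    have h1 : G.dist v w ≤ n := by
      by_contra hc
      apply hw
      obtain ⟨p, hp⟩ := hu
      refine ⟨Walk.cons ha.symm p, ?_⟩
      intro z hz
      rw [Walk.support_cons, List.mem_cons] at hz
      rcases hz with rfl | hz
      · omega
      · exact hp z hz
    have h2 := hC1 u hu
    have h3 := adj_dist hconn v ha.symm
    omega
  have hr' : ∀ t, r (n + 1 + t) ∈ C := by
    intro t
    induction t with
    | zero => 
      refine ⟨Walk.nil, ?_⟩
      intro z hz
      simp only [Walk.support_nil, List.mem_singleton] at hz
      rw [hz, hd]; omega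
    | succ t ih =>
      by_contra hc
      have := (hC2 _ ih _ hc (hr.2 _)).1
      rw [← Nat.add_assoc, hd] at this
      omega
  have hCinf : C.Infinite := by
    apply infinite_of_dist (G := G) v (n+1)
    intro m hm
    refine ⟨r (n + 1 + (m - (n+1))), hr' _, ?_⟩
    rw [hd]; omega
  refine ⟨C, hC1, hC2, ?_, ?_⟩
  · by_contra hc
    refine one_end_sep hconn hlf hone (P := C) ?_ hCinf hc
    refine (ball_finite hconn hlf v (n+1)).subset ?_
    rintro u ⟨hu, w, hw, ha⟩
    exact (hC2 u hu w hw ha).2.le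
  · have hsub : ∀ u, ∀ p : G.Walk u (r (n+1)), (∀ z ∈ p.support, n < G.dist v z) →
        ∀ z ∈ p.support, z ∈ C := by
      intro u p hp z hz
      exact ⟨p.dropUntil z hz, fun z' hz' => hp z' (p.support_dropUntil_subset_support hz hz')⟩
    intro x ⟨px, hpx⟩ o M
    obtain ⟨y, ⟨py, hpy⟩, hy⟩ := exists_far hconn hlf o hCinf M
    refine ⟨y, hy.le, px.append py.reverse, ?_⟩
    intro z hz
    rw [Walk.mem_support_append_iff, Walk.support_reverse, List.mem_reverse] at hz
    rcases hz with hz | hz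
    · exact hsub x px hpx z hz
    · exact hsub y py hpy z hz

/-- The ultralimit argument. -/
lemma limit_contra (hconn : G.Connected) (hlf : ∀ v : V, (G.neighborSet v).Finite)
    (hone : OneEnded G) (v : V) (k N : ℕ) (P : ℕ → Set V)
    (h1 : ∀ j, ∀ T : Finset V, (∀ u ∈ T, u ∈ P j ∧ ∃ w ∉ P j, G.Adj u w) → T.card ≤ k)
    (h2 : ∀ j, ∀ m ≥ N, ∃ x ∈ P j, G.dist v x = m)
    (h3 : ∀ j, ∀ m ≥ N, m ≤ j → ∃ x ∉ P j, G.dist v x = m) : False := by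
  let U := hyperfilter ℕ
  let L : Set V := {x | ∀ᶠ j in (U : Filter ℕ), x ∈ P j}
  have hL : ∀ x, x ∉ L → ∀ᶠ j in (U : Filter ℕ), x ∉ P j := by
    intro x hx
    exact Ultrafilter.eventually_not.2 hx
  have hfin : ∀ m, {x : V | G.dist v x = m}.Finite := fun m =>
    (ball_finite hconn hlf v m).subset (fun x (hx : G.dist v x = m) => hx.le)
  refine one_end_sep hconn hlf hone (P := L) ?_ ?_ ?_
  · by_contra hc
    obtain ⟨T, hT, hTc⟩ := Set.Infinite.exists_subset_card_eq hc (k+1)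
    have hev : ∀ᶠ j in (U : Filter ℕ), ∀ u ∈ T, u ∈ P j ∧ ∃ w ∉ P j, G.Adj u w := by
      rw [Filter.eventually_all_finset]
      intro u hu
      obtain ⟨hu1, w, hw, ha⟩ := hT hu
      filter_upwards [hu1, hL w hw] with j hj1 hj2
      exact ⟨hj1, w, hj2, ha⟩
    obtain ⟨j, hj⟩ := hev.exists
    have := h1 j T hj
    omega
  · apply infinite_of_dist (G := G) v N
    intro m hm
    obtain ⟨x, hx, hx2⟩ := uf_exists U (hfin m) (Q := fun j x => x ∈ P j)
      (Filter.Eventually.of_forall fun j => by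
        obtain ⟨x, hx, hx2⟩ := h2 j m hm
        exact ⟨x, hx2, hx⟩)
    exact ⟨x, hx2, hx⟩
  · apply infinite_of_dist (G := G) v N
    intro m hm
    obtain ⟨x, hx, hx2⟩ := uf_exists U (hfin m) (Q := fun j x => x ∉ P j) (by
      filter_upwards [hyper_ge m] with j hj
      obtain ⟨x, hx, hx2⟩ := h3 j m hm hj
      exact ⟨x, hx2, hx⟩)
    exact ⟨x, Ultrafilter.eventually_not.1 hx2, hx⟩

/-- Finitely generated subgroups have finite orbits. -/
lemma orbit_finite (hconn : G.Connected) (hlf : ∀ v : V, (G.neighborSet v).Finite)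
    (hone : OneEnded G) (v : V) (k : ℕ)
    (hk : ∀ N, ∃ n ≥ N, {u : V | G.dist v u = n + 1}.ncard ≤ k)
    (s : Set (G ≃g G)) (hs : s.Finite) :
    {x | ∃ h ∈ Subgroup.closure s, h v = x}.Finite := by
  classical
  by_contra hinf
  obtain ⟨d, hd⟩ := finite_subset_ball (G := G) v (hs.image (fun a => a v))
  have hd1 : ∀ a ∈ s, G.dist v (a v) ≤ d := fun a ha => hd _ (Set.mem_image_of_mem _ ha)
  have hd2 : ∀ a ∈ s, G.dist v (a⁻¹ v) ≤ d := by
    intro a ha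
    rw [← iso_dist hconn a, RelIso.apply_inv_self, dist_comm]
    exact hd1 a ha
  have main : ∀ j : ℕ, ∃ P : Set V,
      (∀ T : Finset V, (∀ u ∈ T, u ∈ P ∧ ∃ w ∉ P, G.Adj u w) → T.card ≤ k) ∧
      (∀ m ≥ d + 1, ∃ x ∈ P, G.dist v x = m) ∧
      (∀ m ≥ d + 1, m ≤ j → ∃ x ∉ P, G.dist v x = m) := by
    intro j
    obtain ⟨n, hn, hnk⟩ := hk (j + d)
    obtain ⟨C, hC1, hC2, hC3, hC4⟩ := exists_comp hconn hlf hone v n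
    have hvC : v ∉ C := fun h => by simpa using hC1 v h
    -- crossing in the orbit
    have hcross : ∃ h b : G ≃g G, G.dist v (b v) ≤ d ∧ h v ∉ C ∧ h (b v) ∈ C := by
      by_contra hno
      push Not at hno
      apply hinf
      refine hC3.subset ?_
      rintro x ⟨h, hh, rfl⟩
      induction hh using Subgroup.closure_induction_right with
      | one => exact hvC
      | mul_right x hx y hy ih => exact hno x y (hd1 y hy) ih
      | mul_inv_cancel x hx y hy ih => exact hno x y⁻¹ (hd2 y hy) ih
    obtain ⟨h, b, hb, hh1, hh2⟩ := hcross
    obtain ⟨q, hq⟩ := hconn.exists_walk_length_eq_dist (h v) (h (b v))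
    rw [iso_dist hconn] at hq
    obtain ⟨e, he, he1, he2⟩ := q.exists_boundary_dart Cᶜ hh1 (by simpa using hh2)
    have he2' : e.snd ∈ C := by simpa using he2
    have hw : G.dist (h v) e.fst ≤ d := by
      have hm := q.dart_fst_mem_support_of_mem_darts he
      have h1 := dist_le (q.takeUntil e.fst hm)
      have h2 := q.length_takeUntil_le_length hm
      omega
    have hu : G.dist (h v) e.snd ≤ d + 1 := (adj_dist hconn _ e.adj).trans (by omega)
    have hwn := (hC2 _ he2' _ he1 e.adj.symm).1
    refine ⟨{x | h x ∈ C}, ?_, ?_, ?_⟩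
    · intro T hT
      have hsub : ((T.image h : Finset V) : Set V) ⊆ {u : V | G.dist v u = n + 1} := by
        intro z hz
        simp only [Finset.coe_image, Set.mem_image, Finset.mem_coe] at hz
        obtain ⟨u, hu, rfl⟩ := hz
        obtain ⟨h1, w, h2, h3⟩ := hT u hu
        exact (hC2 (h u) h1 (h w) h2 (h.map_rel_iff.2 h3)).2
      have hf : {u : V | G.dist v u = n + 1}.Finite :=
        (ball_finite hconn hlf v (n+1)).subset (fun x (hx : G.dist v x = n+1) => hx.le)
      have := Set.ncard_le_ncard hsub hf
      rw [Set.ncard_coe_finset, Finset.card_image_of_injective _ h.injective] at this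
      omega
    · intro m hm
      obtain ⟨y, hy, w, hwC⟩ := hC4 _ he2' (h v) m
      obtain ⟨z, hz, hzm⟩ := walk_ivt hconn (h v) m w (by omega) hy
      refine ⟨h⁻¹ z, ?_, ?_⟩
      · simp only [Set.mem_ofPred_eq, RelIso.apply_inv_self]
        exact hwC z hz
      · rw [← iso_dist hconn h, RelIso.apply_inv_self, hzm]
    · intro m hm hmj
      obtain ⟨w, hwl⟩ := hconn.exists_walk_length_eq_dist e.fst v
      have h1 := hconn.dist_triangle (u := v) (v := h v) (w := e.fst)
      have h2 := dist_comm (G := G) (u := v) (v := h v)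
      have h3 := dist_comm (G := G) (u := v) (v := e.fst)
      obtain ⟨z, hz, hzm⟩ := walk_ivt hconn (h v) m w (by omega) (by omega)
      refine ⟨h⁻¹ z, ?_, ?_⟩
      · simp only [Set.mem_ofPred_eq, RelIso.apply_inv_self]
        intro hzC
        have h4 := hC1 z hzC
        have h5 := dist_le (w.dropUntil z hz)
        have h6 := w.length_dropUntil_le_length hz
        rw [dist_comm] at h5
        omega
      · rw [← iso_dist hconn h, RelIso.apply_inv_self, hzm]
  choose P hP1 hP2 hP3 using main
  exact limit_contra hconn hlf hone v k (d+1) P hP1 hP2 hP3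

lemma growth_arith (b e : ℕ → ℕ) (c R : ℕ) (h1 : ∀ n, b n + e n ≤ b (n+1))
    (h2 : ∀ n, b n ≤ c * (n + R)) (N : ℕ) : ∃ n ≥ N, e n ≤ c := by
  by_contra hno
  push Not at hno
  have h3 : ∀ m, (c + 1) * m ≤ b (N + m) := by
    intro m
    induction m with
    | zero => simp
    | succ m ih =>
      have := h1 (N + m)
      have := hno (N + m) (by omega)
      rw [← Nat.add_assoc]
      nlinarith
  have h4 := h3 (c * (N + R) + 1)
  have h5 := h2 (N + (c * (N + R) + 1))
  nlinarith

lemma small_boundary (hconn : G.Connected) (hlf : ∀ v : V, (G.neighborSet v).Finite) (v : V) (c : ℕ)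
    (hg : ∀ n : ℕ, 1 ≤ n → {u : V | G.dist v u ≤ n}.ncard ≤ c * n) (O : Set V) (hO : O.Finite)
    (N : ℕ) :
    ∃ n ≥ N, {u : V | (¬ ∃ o ∈ O, G.dist o u ≤ n) ∧ ∃ o ∈ O, G.dist o u ≤ n + 1}.ncard ≤ c := by
  obtain ⟨R, hR⟩ := finite_subset_ball (G := G) v hO
  have hsub : ∀ n, {u : V | ∃ o ∈ O, G.dist o u ≤ n} ⊆ {u : V | G.dist v u ≤ n + R + 1} := by
    rintro n u ⟨o, ho, hu⟩
    have := hR o ho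
    have := hconn.dist_triangle (u := v) (v := o) (w := u)
    simp only [Set.mem_ofPred_eq]; omega
  have hfin : ∀ n, {u : V | ∃ o ∈ O, G.dist o u ≤ n}.Finite := fun n =>
    (ball_finite hconn hlf v _).subset (hsub n)
  refine growth_arith (fun n => {u : V | ∃ o ∈ O, G.dist o u ≤ n}.ncard) _ c (R+1) ?_ ?_ N
  · intro n
    rw [← Set.ncard_union_eq ?_ (hfin n) ((hfin (n+1)).subset fun u hu => hu.2)]
    · apply Set.ncard_le_ncard _ (hfin (n+1))
      rintro u (⟨o, ho, hu⟩ | ⟨-, hu⟩)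
      · exact ⟨o, ho, by omega⟩
      · exact hu
    · rw [Set.disjoint_left]
      intro u hu hu2
      exact hu2.1 hu
  · intro n
    have := Set.ncard_le_ncard (hsub n) (ball_finite hconn hlf v _)
    have := hg (n + R + 1) (by omega)
    rw [← Nat.add_assoc]
    exact le_trans ‹_› ‹_›

open Classical in
/-- cut and paste: `h` inside `B`, the identity outside. -/
noncomputable def cutIso (G : SimpleGraph V) (B : Set V) (h : G ≃g G) (hB : ∀ x, h x ∈ B ↔ x ∈ B)
    (hfix : ∀ u ∈ B, ∀ w ∉ B, G.Adj u w → h w = w) : G ≃g G where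
  toFun x := if x ∈ B then h x else x
  invFun x := if x ∈ B then h.symm x else x
  left_inv x := by
    by_cases hx : x ∈ B
    · simp [hx, hB]
    · simp [hx]
  right_inv x := by
    by_cases hx : x ∈ B
    · have : h.symm x ∈ B := by rw [← hB]; simpa using hx
      simp [hx, this]
    · simp [hx]
  map_rel_iff' := by
    intro a b
    simp only [Equiv.coe_fn_mk]
    by_cases ha : a ∈ B <;> by_cases hb : b ∈ B
    · simp only [ha, hb, if_true]; exact h.map_rel_iff
    · simp only [ha, hb, if_true, if_false]
      constructor
      · intro h1
        have h2 := hfix _ ((hB a).2 ha) b hb h1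
        rw [← h2] at h1
        exact h.map_rel_iff.1 h1
      · intro h1
        have h2 := hfix a ha b hb h1
        rw [← h2]
        exact h.map_rel_iff.2 h1
    · simp only [ha, hb, if_true, if_false]
      constructor
      · intro h1
        have h2 := hfix _ ((hB b).2 hb) a ha h1.symm
        rw [← h2] at h1
        exact h.map_rel_iff.1 h1
      · intro h1
        have h2 := hfix b hb a ha h1.symm
        rw [← h2]
        exact h.map_rel_iff.2 h1
    · simp only [ha, hb, if_false]

lemma exists_finsupp (hconn : G.Connected) (hlf : ∀ v : V, (G.neighborSet v).Finite)
    (hone : OneEnded G) (v : V) (c : ℕ)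
    (hg : ∀ n : ℕ, 1 ≤ n → {u : V | G.dist v u ≤ n}.ncard ≤ c * n)
    (X : Set V) (hX : X.Finite) (hXt : ∀ g : G ≃g G, (∀ x ∈ X, g x = x) → g = 1)
    [Infinite (G ≃g G)] :
    ∃ (f : G ≃g G) (x : V), f x ≠ x ∧ {x | f x ≠ x}.Finite := by
  classical
  obtain ⟨s, hs⟩ := Infinite.exists_subset_card_eq (G ≃g G) ((c+1)^(c+1) + 1)
  have hk : ∀ N, ∃ n ≥ N, {u : V | G.dist v u = n + 1}.ncard ≤ c := by
    intro N
    obtain ⟨n, hn, h⟩ := small_boundary hconn hlf v c hg {v} (Set.finite_singleton v) N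
    refine ⟨n, hn, ?_⟩
    convert h using 3
    ext u
    simp only [Set.mem_singleton_iff, exists_eq_left]
    omega
  have hOf := orbit_finite hconn hlf hone v c hk (s : Set (G ≃g G)) s.finite_toSet
  set O : Set V := {x | ∃ h ∈ Subgroup.closure (s : Set (G ≃g G)), h v = x} with hO
  have hOinv : ∀ h ∈ Subgroup.closure (s : Set (G ≃g G)), ∀ x ∈ O, h x ∈ O := by
    rintro h hh x ⟨g, hg, rfl⟩
    exact ⟨h * g, mul_mem hh hg, rfl⟩
  have hvO : v ∈ O := ⟨1, one_mem _, rfl⟩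
  obtain ⟨N, hN⟩ := finite_subset_ball (G := G) v hX
  obtain ⟨n, hn, hcard⟩ := small_boundary hconn hlf v c hg O hOf N
  set D := {u : V | (¬ ∃ o ∈ O, G.dist o u ≤ n) ∧ ∃ o ∈ O, G.dist o u ≤ n + 1} with hD
  have hBn1 : ∀ m, {u : V | ∃ o ∈ O, G.dist o u ≤ m}.Finite := by
    intro m
    have : {u : V | ∃ o ∈ O, G.dist o u ≤ m} = ⋃ o ∈ O, {u | G.dist o u ≤ m} := by
      ext u; simp
    rw [this]
    exact hOf.biUnion fun o _ => ball_finite hconn hlf o m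
  have hDf : D.Finite := (hBn1 (n+1)).subset fun u hu => hu.2
  have hinv1 : ∀ h ∈ Subgroup.closure (s : Set (G ≃g G)), ∀ m x,
      (∃ o ∈ O, G.dist o x ≤ m) → ∃ o ∈ O, G.dist o (h x) ≤ m := by
    rintro h hh m x ⟨o, ho, hox⟩
    exact ⟨h o, hOinv h hh o ho, by rwa [iso_dist hconn]⟩
  have hinv : ∀ h ∈ Subgroup.closure (s : Set (G ≃g G)), ∀ m x,
      (∃ o ∈ O, G.dist o (h x) ≤ m) ↔ ∃ o ∈ O, G.dist o x ≤ m := by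
    intro h hh m x
    refine ⟨fun hx => ?_, hinv1 h hh m x⟩
    have := hinv1 h⁻¹ (inv_mem hh) m (h x) hx
    rwa [RelIso.inv_apply_self] at this
  have hDinv : ∀ h ∈ s, ∀ x ∈ D, h x ∈ D := by
    intro h hh x hx
    have hh' := Subgroup.subset_closure (Finset.mem_coe.2 hh)
    exact ⟨fun h1 => hx.1 ((hinv h hh' n x).1 h1), (hinv h hh' (n+1) x).2 hx.2⟩
  -- pigeonhole
  have : Fintype D := hDf.fintype
  let F : {h // h ∈ s} → (D → D) := fun h x => ⟨h.1 x.1, hDinv h.1 h.2 x.1 x.2⟩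
  have hcD : Fintype.card D ≤ c := by
    rw [← Nat.card_eq_fintype_card, Nat.card_coe_set_eq]; exact hcard
  have hlt : Fintype.card (D → D) < Fintype.card {h // h ∈ s} := by
    rw [Fintype.card_fun, Fintype.card_coe, hs]
    have h1 : Fintype.card D ^ Fintype.card D ≤ (c+1) ^ Fintype.card D :=
      Nat.pow_le_pow_left (by omega) _
    have h2 : (c+1) ^ Fintype.card D ≤ (c+1)^(c+1) := Nat.pow_le_pow_right (by omega) (by omega)
    omega
  obtain ⟨a, b, hab, hFab⟩ := Fintype.exists_ne_map_eq_of_card_lt F hlt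
  let h : G ≃g G := a.1⁻¹ * b.1
  have hh : h ∈ Subgroup.closure (s : Set (G ≃g G)) :=
    mul_mem (inv_mem (Subgroup.subset_closure a.2)) (Subgroup.subset_closure b.2)
  have hhD : ∀ x ∈ D, h x = x := by
    intro x hx
    have h1 : a.1 x = b.1 x := congrArg Subtype.val (congrFun hFab ⟨x, hx⟩)
    change a.1⁻¹ (b.1 x) = x
    rw [← h1, RelIso.inv_apply_self]
  have hne : h ≠ 1 := by
    intro h1
    apply hab
    apply Subtype.ext
    exact inv_mul_eq_one.1 h1
  have hx : ∃ x ∈ X, h x ≠ x := by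
    by_contra hno
    push Not at hno
    exact hne (hXt h hno)
  obtain ⟨x, hxX, hxne⟩ := hx
  have hxB : ∃ o ∈ O, G.dist o x ≤ n := ⟨v, hvO, (hN x hxX).trans hn⟩
  refine ⟨cutIso G {u : V | ∃ o ∈ O, G.dist o u ≤ n} h (fun x => hinv h hh n x) ?_, x, ?_, ?_⟩
  · rintro u ⟨o, ho, hu⟩ w hw ha
    exact hhD w ⟨hw, o, ho, (adj_dist hconn o ha).trans (by omega)⟩
  · change (if _ then _ else _) ≠ _
    rw [if_pos (show x ∈ {u : V | ∃ o ∈ O, G.dist o u ≤ n} from hxB)]; exact hxne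
  · refine (hBn1 n).subset ?_
    intro y hy
    by_contra hc
    apply hy
    change (if _ then _ else _) = _
    rw [if_neg hc]

lemma finite_of_orbit_finite (hconn : G.Connected) (hlf : ∀ v : V, (G.neighborSet v).Finite)
    (X : Set V) (hX : X.Finite) (hXt : ∀ g : G ≃g G, (∀ x ∈ X, g x = x) → g = 1) (v : V)
    (hv : (Set.range fun g : G ≃g G => g v).Finite) : Finite (G ≃g G) := by
  obtain ⟨R, hR⟩ := finite_subset_ball (G := G) v hv
  obtain ⟨N, hN⟩ := finite_subset_ball (G := G) v hX
  have hbf := ball_finite hconn hlf v (R + N)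
  have := hbf.to_subtype
  have := hX.to_subtype
  let F : (G ≃g G) → (X → {u : V | G.dist v u ≤ R + N}) := fun g x => ⟨g x.1, by
    have h1 := hR (g v) ⟨g, rfl⟩
    have h2 := hN x.1 x.2
    have h3 := hconn.dist_triangle (u := v) (v := g v) (w := g x.1)
    rw [iso_dist hconn] at h3
    simp only [Set.mem_ofPred_eq]; omega⟩
  apply Finite.of_injective F
  intro a b hab
  have : a⁻¹ * b = 1 := by
    apply hXt
    intro x hx
    have h1 : a x = b x := congrArg Subtype.val (congrFun hab ⟨x, hx⟩)
    change a⁻¹ (b x) = x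
    rw [← h1, RelIso.inv_apply_self]
  exact inv_mul_eq_one.1 this

lemma finite_of_trivial_fixator (hconn : G.Connected) (hlf : ∀ v : V, (G.neighborSet v).Finite)
    (hone : OneEnded G) (v : V) (c : ℕ)
    (hg : ∀ n : ℕ, 1 ≤ n → {u : V | G.dist v u ≤ n}.ncard ≤ c * n)
    (X : Set V) (hX : X.Finite) (hXt : ∀ g : G ≃g G, (∀ x ∈ X, g x = x) → g = 1) :
    Finite (G ≃g G) := by
  by_contra hinf
  have : Infinite (G ≃g G) := not_finite_iff_infinite.1 hinf
  obtain ⟨f, x0, hx0, hf⟩ := exists_finsupp hconn hlf hone v c hg X hX hXt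
  have horb : (Set.range fun g : G ≃g G => g x0).Infinite := fun h =>
    hinf (finite_of_orbit_finite hconn hlf X hX hXt x0 h)
  obtain ⟨R, hR⟩ := finite_subset_ball (G := G) x0 hf
  obtain ⟨N, hN⟩ := finite_subset_ball (G := G) v hX
  obtain ⟨_, ⟨g, rfl⟩, hgd⟩ := exists_far hconn hlf v horb (N + R)
  have h1 : g * f * g⁻¹ = 1 := by
    apply hXt
    intro x hx
    change g (f (g⁻¹ x)) = x
    by_cases hc : f (g⁻¹ x) = g⁻¹ x
    · rw [hc, RelIso.apply_inv_self]
    · exfalso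
      have h2 := hR (g⁻¹ x) hc
      rw [← iso_dist hconn g, RelIso.apply_inv_self, dist_comm] at h2
      have h3 := hN x hx
      have h4 := hconn.dist_triangle (u := v) (v := x) (w := g x0)
      simp only at hgd
      omega
  have h2 : f = 1 := by
    have := congrArg (fun t => g⁻¹ * t * g) h1
    simpa [mul_assoc] using this
  apply hx0
  rw [h2]; rfl

lemma countable_V (hconn : G.Connected) (hlf : ∀ v : V, (G.neighborSet v).Finite) : Countable V := by
  obtain ⟨v⟩ := hconn.nonempty
  rw [← Set.countable_univ_iff]
  have : (Set.univ : Set V) = ⋃ n : ℕ, {u | G.dist v u ≤ n} := by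
    ext u
    simp only [Set.mem_univ, Set.mem_iUnion, true_iff]
    exact ⟨G.dist v u, le_refl (G.dist v u)⟩
  rw [this]
  exact Set.countable_iUnion fun n => (ball_finite hconn hlf v n).countable

lemma card_continuum [Countable V]
    (hX : ∀ X : Set V, X.Finite → ∃ g : G ≃g G, (∀ x ∈ X, g x = x) ∧ g ≠ 1) :
    Cardinal.mk (G ≃g G) = Cardinal.continuum := by
  apply le_antisymm
  · have h1 : Cardinal.mk (G ≃g G) ≤ Cardinal.mk (V → V) :=
      Cardinal.mk_le_of_injective (f := fun g : G ≃g G => (g : V → V)) DFunLike.coe_injective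
    refine h1.trans ?_
    obtain ⟨e, he⟩ := exists_injective_nat V
    have h2 : Cardinal.mk (V → V) ≤ Cardinal.mk (Set (V × V)) := by
      apply Cardinal.mk_le_of_injective (f := fun f : V → V => {p : V × V | f p.1 = p.2})
      intro f g hfg
      funext x
      have : (x, f x) ∈ {p : V × V | g p.1 = p.2} := by
        rw [← show {p : V × V | f p.1 = p.2} = {p : V × V | g p.1 = p.2} from hfg]
        rfl
      exact Eq.symm this
    refine h2.trans ?_
    rw [Cardinal.mk_set, ← Cardinal.two_power_aleph0]
    exact Cardinal.power_le_power_left two_ne_zero (Cardinal.mk_le_aleph0)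
  · let : TopologicalSpace V := ⊥
    have : DiscreteTopology V := ⟨rfl⟩
    let φ : (G ≃g G) → (V → V) × (V → V) := fun g => (g, g.symm)
    have hφ : Function.Injective φ := by
      intro a b hab
      exact DFunLike.coe_injective (congrArg Prod.fst hab)
    have hcl : IsClosed (Set.range φ) := by
      have : Set.range φ = ⋂ x : V, ⋂ y : V, {p | (p.1 x = y ↔ p.2 y = x) ∧
          (G.Adj (p.1 x) (p.1 y) ↔ G.Adj x y)} := by
        ext p
        simp only [Set.mem_iInter]
        constructor
        · rintro ⟨g, rfl⟩ x y
          refine ⟨⟨?_, ?_⟩, g.map_rel_iff⟩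
          · rintro rfl
            exact g.symm_apply_apply x
          · rintro rfl
            exact g.apply_symm_apply y
        · intro hp
          exact ⟨⟨⟨p.1, p.2, fun x => (hp x _).1.1 rfl, fun x => (hp _ x).1.2 rfl⟩,
            fun {a b} => (hp a b).2⟩, rfl⟩
      rw [this]
      refine isClosed_iInter fun x => isClosed_iInter fun y => ?_
      have hψ : Continuous fun p : (V → V) × (V → V) => (p.1 x, p.1 y, p.2 y) := by fun_prop
      exact (isClosed_discrete {q : V × V × V | (q.1 = y ↔ q.2.2 = x) ∧
          (G.Adj q.1 q.2.1 ↔ G.Adj x y)}).preimage hψ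
    have hpol : PolishSpace V := inferInstance
    have hunc : ¬ (Set.range φ).Countable := by
      intro hc
      have hctb : Countable (Set.range φ) := hc.to_subtype
      have hPS : PolishSpace (Set.range φ) := hcl.polishSpace
      have hne : Nonempty (Set.range φ) := ⟨⟨φ 1, 1, rfl⟩⟩
      obtain ⟨⟨_, g, rfl⟩, hi⟩ := nonempty_interior_of_iUnion_of_closed
        (f := fun s : Set.range φ => ({s} : Set (Set.range φ)))
        (fun s => isClosed_singleton) (Set.iUnion_of_singleton _)
      obtain ⟨z, hz⟩ := hi
      have hzg : z = ⟨φ g, g, rfl⟩ := Set.mem_singleton_iff.1 (interior_subset hz)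
      have hnh : ({⟨φ g, g, rfl⟩} : Set (Set.range φ)) ∈ nhds (⟨φ g, g, rfl⟩ : Set.range φ) := by
        rw [hzg] at hz
        exact mem_interior_iff_mem_nhds.1 hz
      choose h hh1 hh2 using fun X : Finset V => hX (X : Set V) X.finite_toSet
      have htend : Tendsto (fun X : Finset V => (⟨φ (g * h X), g * h X, rfl⟩ : Set.range φ)) atTop
          (nhds ⟨φ g, g, rfl⟩) := by
        rw [tendsto_subtype_rng]
        refine Tendsto.prodMk_nhds ?_ ?_
        · rw [tendsto_pi_nhds]
          intro x
          apply tendsto_nhds_of_eventually_eq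
          filter_upwards [eventually_ge_atTop {x}] with X hXx
          change g (h X x) = g x
          rw [hh1 X x (hXx (Finset.mem_singleton_self x))]
        · rw [tendsto_pi_nhds]
          intro y
          apply tendsto_nhds_of_eventually_eq
          filter_upwards [eventually_ge_atTop {g.symm y}] with X hXx
          change (h X).symm (g.symm y) = g.symm y
          rw [RelIso.symm_apply_eq]
          exact (hh1 X _ (hXx (Finset.mem_singleton_self _))).symm
      obtain ⟨X, hXm⟩ := (htend.eventually_mem hnh).exists
      have h5 : φ (g * h X) = φ g := congrArg Subtype.val hXm
      exact hh2 X (mul_eq_left.1 (hφ h5))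
    obtain ⟨f, hf1, -, hf2⟩ := hcl.exists_nat_bool_injection_of_not_countable hunc
    have h3 : Cardinal.mk (ℕ → Bool) ≤ Cardinal.mk (Set.range φ) :=
      Cardinal.mk_le_of_injective (f := fun t => (⟨f t, hf1 ⟨t, rfl⟩⟩ : Set.range φ))
        (fun a b hab => hf2 (congrArg Subtype.val hab))
    rw [Cardinal.mk_range_eq _ hφ] at h3
    refine le_trans (le_of_eq ?_) h3
    simp

end Helpers

/-- a connected locally finite one-ended graph with linear growth has an
automorphism group that is finite or of cardinality exactly `2^ℵ₀`. -/
theorem linear_growth_one_ended_dichotomy {V : Type} (G : SimpleGraph V)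
    (hconn : G.Connected)
    (hlf : ∀ v : V, (G.neighborSet v).Finite)
    (hgrowth : ∃ (v : V) (c : ℕ), ∀ n : ℕ, 1 ≤ n →
      {u : V | G.dist v u ≤ n}.ncard ≤ c * n)
    (hone : OneEnded G) :
    Finite (G ≃g G) ∨ Cardinal.mk (G ≃g G) = Cardinal.continuum := by
  obtain ⟨v, c, hg⟩ := hgrowth
  by_cases h : ∃ X : Set V, X.Finite ∧ ∀ g : G ≃g G, (∀ x ∈ X, g x = x) → g = 1
  · obtain ⟨X, hX, hXt⟩ := h
    exact Or.inl (finite_of_trivial_fixator hconn hlf hone v c hg X hX hXt)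
  · right
    have := countable_V hconn hlf
    apply card_continuum
    intro X hX
    by_contra hc
    push Not at hc
    exact h ⟨X, hX, hc⟩

end PaperEnds
end
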